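/- Let C be a clone on {0,1,2} such that every operation in C is idempotent, C contains a Mal'cev operation, C contains no majority operation, and some operation in C does not preserve the relation φ = {(0,1),(1,2),(2,0)}. Then C is minor-equivalent to 𝒵₂, the clone on {0,1} of all operations preserving the relation {(x,y,z,w) ∈ {0,1}⁴ : w = x+y+z mod 2} and the singleton relations {0} and {1}; that is, there exist minion homomorphisms from C to 𝒵₂ and from 𝒵₂ to C. -/

import Mathlib

/-- `f` preserves the `k`-ary relation `R`. -/
def Preserves {A : Type} {n k : ℕ} (f : (Fin n → A) → A) (R : Set (Fin k → A)) : Prop :=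
  ∀ r : Fin n → Fin k → A, (∀ i, r i ∈ R) → (fun j => f fun i => r i j) ∈ R

/-- A family of operations on `A`, indexed so that `C n` are the `(n+1)`-ary operations. -/
abbrev Ops (A : Type) := ∀ n : ℕ, Set ((Fin (n + 1) → A) → A)

/-- `C` is a clone: it contains all projections and is closed under composition. -/
structure IsClone {A : Type} (C : Ops A) : Prop where
  proj : ∀ (n : ℕ) (i : Fin (n + 1)), (fun x => x i) ∈ C n
  comp : ∀ (n m : ℕ) (f : (Fin (n + 1) → A) → A) (g : Fin (n + 1) → (Fin (m + 1) → A) → A),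
      f ∈ C n → (∀ i, g i ∈ C m) → (fun x => f fun i => g i x) ∈ C m

/-- The minor of `f` along `σ`. -/
def Minor {A : Type} {n r : ℕ} (f : (Fin n → A) → A) (σ : Fin n → Fin r) :
    (Fin r → A) → A := fun x => f (x ∘ σ)

/-- `ξ` is a minion homomorphism from `C` to `D`: it maps members of `C` to members of `D`
and commutes with taking minors (on members of `C`). -/
def IsMinionHom {A B : Type} (C : Ops A) (D : Ops B)
    (ξ : ∀ n : ℕ, ((Fin (n + 1) → A) → A) → ((Fin (n + 1) → B) → B)) : Prop :=
  (∀ n f, f ∈ C n → ξ n f ∈ D n) ∧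
    ∀ (n r : ℕ) (f : (Fin (n + 1) → A) → A) (σ : Fin (n + 1) → Fin (r + 1)),
      f ∈ C n → ξ r (Minor f σ) = Minor (ξ n f) σ

/-- There exists a minion homomorphism from `C` to `D`. -/
def MinorLE {A B : Type} (C : Ops A) (D : Ops B) : Prop := ∃ ξ, IsMinionHom C D ξ

/-- `C` and `D` are minor-equivalent. -/
def MinorEquiv {A B : Type} (C : Ops A) (D : Ops B) : Prop := MinorLE C D ∧ MinorLE D C

/-- A subset of `A` viewed as a unary relation. -/
def unRel {A : Type} (s : Set A) : Set (Fin 1 → A) := {t | t 0 ∈ s}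

def psi2 : Set (Fin 2 → Fin 3) :=
  {t | (t 0, t 1) ∈ ({(0, 1), (1, 0), (2, 2)} : Set (Fin 3 × Fin 3))}

def psi2' : Set (Fin 2 → Fin 3) :=
  {t | (t 0, t 1) ∈ ({(0, 1), (1, 0)} : Set (Fin 3 × Fin 3))}

def phi : Set (Fin 2 → Fin 3) :=
  {t | (t 0, t 1) ∈ ({(0, 1), (1, 2), (2, 0)} : Set (Fin 3 × Fin 3))}

def mu2 : Set (Fin 2 → Fin 3) :=
  {t | (t 0, t 1) ∈ ({(0, 0), (1, 1), (2, 2), (0, 1), (1, 0)} : Set (Fin 3 × Fin 3))}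

def rho2 : Set (Fin 2 → Fin 3) :=
  {t | (t 0, t 1) ∈ ({(0, 2), (1, 2), (2, 0), (2, 1)} : Set (Fin 3 × Fin 3))}

/-- The minority value of `x, y, z` when at most two distinct values occur
(and `x` if all three are distinct). -/
def mino {A : Type} [DecidableEq A] (x y z : A) : A :=
  if x = y then z else if x = z then y else x

/-- The relation `T_i' = {(x,y,z,min(x,y,z)) : x,y,z ≠ i}`. -/
def Tprime (i : Fin 3) : Set (Fin 4 → Fin 3) :=
  {t | t 0 ≠ i ∧ t 1 ≠ i ∧ t 2 ≠ i ∧ t 3 = mino (t 0) (t 1) (t 2)}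

/-- The relation `T₂ = T₂' ∪ {(2,2,2,2)}`. -/
def T2rel : Set (Fin 4 → Fin 3) := insert (fun _ => 2) (Tprime 2)

/-- The relation `T = {(x,y,z,x-y+z mod 3)}`. -/
def Trel : Set (Fin 4 → Fin 3) := {t | t 3 = t 0 - t 1 + t 2}

def neqRel : Set (Fin 2 → Fin 2) := {t | t 0 ≠ t 1}

/-- The relation `{(x,y,z,w) ∈ {0,1}⁴ : w = x+y+z mod 2}`. -/
def Z2rel : Set (Fin 4 → Fin 2) := {t | t 3 = t 0 + t 1 + t 2}

/-- `ℐ₂ = Pol({0},{1})` on `{0,1}`. -/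
def CloneI2 : Ops (Fin 2) := fun _ =>
  {f | Preserves f (unRel {0}) ∧ Preserves f (unRel {1})}

/-- `𝒞₂ = Pol(≠,{0},{1})` on `{0,1}`. -/
def CloneC2 : Ops (Fin 2) := fun _ =>
  {f | Preserves f neqRel ∧ Preserves f (unRel {0}) ∧ Preserves f (unRel {1})}

/-- `𝒵₂ = Pol({(x,y,z,w) : w = x+y+z mod 2},{0},{1})` on `{0,1}`. -/
def CloneZ2 : Ops (Fin 2) := fun _ =>
  {f | Preserves f Z2rel ∧ Preserves f (unRel {0}) ∧ Preserves f (unRel {1})}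


/-! ## Basic tools -/

/-- `s` is a Mal'cev operation of `C`. -/
def Mal (C : Ops (Fin 3)) (s : (Fin (2 + 1) → Fin 3) → Fin 3) : Prop :=
  s ∈ C 2 ∧ ∀ x y : Fin 3, s ![y, x, x] = y ∧ s ![x, x, y] = y

/-- All operations of the clone are idempotent. -/
def Idem (C : Ops (Fin 3)) : Prop := ∀ n, ∀ f ∈ C n, ∀ a : Fin 3, f (fun _ => a) = a

lemma comp3 {C : Ops (Fin 3)} (hC : IsClone C) {n : ℕ} {s : (Fin (2 + 1) → Fin 3) → Fin 3}
    (hs : s ∈ C 2) {f g h : (Fin (n + 1) → Fin 3) → Fin 3}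
    (hf : f ∈ C n) (hg : g ∈ C n) (hh : h ∈ C n) :
    (fun x => s ![f x, g x, h x]) ∈ C n := by
  have h1 := hC.comp 2 n s ![f, g, h] hs (by intro i; fin_cases i <;> simpa)
  have h2 : (fun x => s ![f x, g x, h x]) = fun x => s fun i => (![f, g, h] : Fin 3 → _) i x := by
    funext x
    congr 1
    funext i
    fin_cases i <;> rfl
  rw [h2]
  exact h1

/-- Two elements of the relation `C n` that agree on `J` take the values `u`, `v` at `x`. -/
def Fork (C : Ops (Fin 3)) (n : ℕ) (J : Set (Fin (n + 1) → Fin 3)) (x : Fin (n + 1) → Fin 3)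
    (u v : Fin 3) : Prop :=
  ∃ f ∈ C n, ∃ g ∈ C n, (∀ y ∈ J, f y = g y) ∧ f x = u ∧ g x = v

section
variable {C : Ops (Fin 3)} {n : ℕ} {J K : Set (Fin (n + 1) → Fin 3)} {x : Fin (n + 1) → Fin 3}
  {u v w : Fin 3} {m : (Fin (2 + 1) → Fin 3) → Fin 3}

lemma Fork.refl {f : (Fin (n + 1) → Fin 3) → Fin 3} (hf : f ∈ C n) : Fork C n J x (f x) (f x) :=
  ⟨f, hf, f, hf, fun _ _ => rfl, rfl, rfl⟩

lemma Fork.symm (h : Fork C n J x u v) : Fork C n J x v u := by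
  obtain ⟨f, hf, g, hg, h1, h2, h3⟩ := h
  exact ⟨g, hg, f, hf, fun y hy => (h1 y hy).symm, h3, h2⟩

lemma Fork.left (h : Fork C n J x u v) : ∃ f ∈ C n, f x = u := by
  obtain ⟨f, hf, g, hg, h1, h2, h3⟩ := h
  exact ⟨f, hf, h2⟩

lemma Fork.shift (hC : IsClone C) (hm : Mal C m) (h : Fork C n J x u v)
    {r : (Fin (n + 1) → Fin 3) → Fin 3} (hr : r ∈ C n) (hrx : r x = u) :
    ∃ s ∈ C n, (∀ y ∈ J, s y = r y) ∧ s x = v := by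
  obtain ⟨f, hf, g, hg, h1, h2, h3⟩ := h
  refine ⟨_, comp3 hC hm.1 hr hf hg, ?_, ?_⟩
  · intro y hy
    simp only [h1 y hy]
    exact (hm.2 _ _).1
  · simp only [h2, h3, hrx]
    exact (hm.2 _ _).2

lemma Fork.trans (hC : IsClone C) (hm : Mal C m) (h : Fork C n J x u v) (h' : Fork C n J x v w) :
    Fork C n J x u w := by
  obtain ⟨f, hf, g, hg, h1, h2, h3⟩ := h
  obtain ⟨s, hs, h4, h5⟩ := h'.shift hC hm hg h3
  exact ⟨f, hf, s, hs, fun y hy => by rw [h1 y hy, h4 y hy], h2, h5⟩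

lemma Fork.mono (hJ : K ⊆ J) (h : Fork C n J x u v) : Fork C n K x u v := by
  obtain ⟨f, hf, g, hg, h1, h2, h3⟩ := h
  exact ⟨f, hf, g, hg, fun y hy => h1 y (hJ hy), h2, h3⟩

lemma Fork.compat (hC : IsClone C) {k : ℕ} {h : (Fin (k + 1) → Fin 3) → Fin 3} (hh : h ∈ C k)
    {a b : Fin (k + 1) → Fin 3} (hab : ∀ i, Fork C n J x (a i) (b i)) :
    Fork C n J x (h a) (h b) := by
  choose f hf g hg h1 h2 h3 using hab
  refine ⟨_, hC.comp k n h f hh hf, _, hC.comp k n h g hh hg, ?_, ?_, ?_⟩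
  · intro y hy
    simp only [h1 _ y hy]
  · simp only [h2]
  · simp only [h3]

/-- The commutator computation used for both the abelian and the non-uniform case. -/
lemma Fork.diff (hC : IsClone C) (hm : Mal C m) {o d : Fin 3}
    (h1 : Fork C n J x o w) (h2 : Fork C n K x o d) :
    Fork C n (J ∪ K) x (m ![o, w, m ![w, o, d]]) d := by
  obtain ⟨r, hr, U, hU, hJ, hrx, hUx⟩ := h1
  obtain ⟨V, hV, hK, hVx⟩ := h2.shift hC hm hr hrx
  refine ⟨_, comp3 hC hm.1 hr hU (comp3 hC hm.1 hU hr hV), V, hV, ?_, ?_, hVx⟩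
  · rintro y (hy | hy)
    · simp only [← hJ y hy, (hm.2 _ _).2]
    · simp only [hK y hy, (hm.2 _ _).1]
  · simp only [hrx, hUx, hVx]

/-- A fixed-point-free injection commuting with the clone gives `φ`. -/
lemma phi_of_comm {σ : Fin 3 → Fin 3} (hinj : Function.Injective σ) (hfix : ∀ z, σ z ≠ z)
    (hcomm : ∀ n, ∀ f ∈ C n, ∀ x, f (fun l => σ (x l)) = σ (f x)) :
    ∀ n, ∀ f ∈ C n, Preserves f phi := by
  have hphi : ∀ t : Fin 2 → Fin 3, t ∈ phi ↔ t 1 = t 0 + 1 := by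
    intro t
    have : ∀ a b : Fin 3, ((a, b) = ((0 : Fin 3), (1 : Fin 3)) ∨ (a, b) = ((1 : Fin 3), (2 : Fin 3))
      ∨ (a, b) = ((2 : Fin 3), (0 : Fin 3))) ↔ b = a + 1 := by decide
    exact this (t 0) (t 1)
  have key : ∀ a b c : Fin 3, a ≠ 0 → b ≠ 1 → c ≠ 2 → a ≠ b → a ≠ c → b ≠ c →
      (a = 1 ∧ b = 2 ∧ c = 0) ∨ (a = 2 ∧ b = 0 ∧ c = 1) := by decide
  have h1 := key (σ 0) (σ 1) (σ 2) (hfix 0) (hfix 1) (hfix 2) (fun h => by simpa using hinj h)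
    (fun h => by simpa using hinj h) (fun h => by simpa using hinj h)
  have hplus : ∀ n, ∀ f ∈ C n, ∀ x, f (fun l => x l + 1) = f x + 1 := by
    intro n f hf x
    rcases h1 with ⟨h0, h1, h2⟩ | ⟨h0, h1, h2⟩
    · have : ∀ z, σ z = z + 1 := by intro z; fin_cases z <;> simp [h0, h1, h2]
      simpa only [this] using hcomm n f hf x
    · have : ∀ z, z + 1 = σ (σ z) := by intro z; fin_cases z <;> simp [h0, h1, h2]
      simp only [this]
      rw [hcomm n f hf (fun l => σ (x l)), hcomm n f hf x]
  intro n f hf r hr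
  rw [hphi]
  have : (fun i => r i 1) = fun i => r i 0 + 1 := by
    funext i
    exact (hphi _).1 (hr i)
  simp only [this]
  exact hplus n f hf _

/-- The abelian case forces `φ`. -/
lemma abelian_phi (hC : IsClone C) (hid : Idem C) (hm : Mal C m) (o : Fin 3)
    (hJ : ∀ u, Fork C n J x o u) (hK : ∀ u, Fork C n K x o u)
    (hJK : ∀ u v, Fork C n (J ∪ K) x u v → u = v) :
    ∀ n, ∀ f ∈ C n, Preserves f phi := by
  have h3 : ∀ w d, m ![o, w, m ![w, o, d]] = d := fun w d => hJK _ _ ((hJ w).diff hC hm (hK d))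
  obtain ⟨r, hr, hrx⟩ := (hJ o).left
  have hU : ∀ u, ∃ U ∈ C n, (∀ y ∈ J, U y = r y) ∧ U x = u := fun u => (hJ u).shift hC hm hr hrx
  have hV : ∀ u, ∃ U ∈ C n, (∀ y ∈ K, U y = r y) ∧ U x = u := fun u => (hK u).shift hC hm hr hrx
  choose U hU1 hU2 hU3 using hU
  choose V hV1 hV2 hV3 using hV
  have hinj : ∀ w d, m ![m ![w, o, d], d, o] = w := by
    intro w d
    apply hJK
    refine ⟨_, comp3 hC hm.1 (comp3 hC hm.1 (hU1 w) hr (hV1 d)) (hV1 d) hr, U w, hU1 w, ?_, ?_, hU3 w⟩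
    · rintro y (hy | hy)
      · simp only [hU2 _ y hy, (hm.2 _ _).2]
      · simp only [hV2 _ y hy, (hm.2 _ _).1]
    · simp only [hU3, hV3, hrx]
  have hcomm : ∀ k, ∀ h ∈ C k, ∀ (u : Fin (k + 1) → Fin 3) (d : Fin 3),
      h (fun l => m ![u l, o, d]) = m ![h u, o, d] := by
    intro k h hh u d
    apply hJK
    refine ⟨_, hC.comp k n h (fun l y => m ![U (u l) y, r y, V d y]) hh
      (fun l => comp3 hC hm.1 (hU1 _) hr (hV1 _)), _,
      comp3 hC hm.1 (hC.comp k n h (fun l => U (u l)) hh (fun l => hU1 _)) hr (hV1 d), ?_, ?_, ?_⟩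
    · rintro y (hy | hy)
      · simp only [hU2 _ y hy, (hm.2 _ _).2, hid k h hh]
      · simp only [hV2 _ y hy, (hm.2 _ _).1]
    · simp only [hU3, hV3, hrx]
    · simp only [hU3, hV3, hrx]
  refine phi_of_comm (σ := fun w => m ![w, o, o + 1]) ?_ ?_ ?_
  · intro a b hab
    have ha := hinj a (o + 1)
    have hb := hinj b (o + 1)
    replace hab : m ![a, o, o + 1] = m ![b, o, o + 1] := hab
    rw [hab] at ha
    exact ha.symm.trans hb
  · intro z hz
    have := h3 z (o + 1)
    replace hz : m ![z, o, o + 1] = z := hz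
    rw [hz, (hm.2 _ _).1] at this
    revert this
    clear * -
    revert o
    decide
  · intro k f hf x
    exact hcomm k f hf x (o + 1)

lemma three_classes {E : Fin 3 → Fin 3 → Prop} (hs : ∀ u v, E u v → E v u) {t a u : Fin 3}
    (h1 : ¬ E t a) (h2 : ¬ E u t) (h3 : ¬ E u a) (e1 : E t t) (e2 : E a a) :
    (∀ v, v = t ∨ v = a ∨ v = u) ∧ ∀ v w, E v w → v = w := by
  have n1 : t ≠ a := by rintro rfl; exact h1 e1
  have n2 : u ≠ t := by rintro rfl; exact h2 e1
  have n3 : u ≠ a := by rintro rfl; exact h3 e2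
  have hall : ∀ v, v = t ∨ v = a ∨ v = u := by
    clear * - n1 n2 n3
    revert t a u
    decide
  refine ⟨hall, fun v w hvw => ?_⟩
  rcases hall v with rfl | rfl | rfl <;> rcases hall w with rfl | rfl | rfl <;>
    first
    | rfl
    | exact absurd hvw ‹_›
    | exact absurd (hs _ _ hvw) ‹_›

end

/-! ## Two-element quotients -/

/-- `D` is closed under `C` and (the kernel of) `π` is compatible with `C` on `D`. -/
structure Quo (C : Ops (Fin 3)) (D : Fin 3 → Prop) (π : Fin 3 → Fin 2) : Prop where
  closed : ∀ n, ∀ f ∈ C n, ∀ x, (∀ l, D (x l)) → D (f x)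
  comp : ∀ n, ∀ f ∈ C n, ∀ x y, (∀ l, D (x l)) → (∀ l, D (y l)) → (∀ l, π (x l) = π (y l)) →
    π (f x) = π (f y)

section
variable {C : Ops (Fin 3)} {n : ℕ} {m : (Fin (2 + 1) → Fin 3) → Fin 3} {D : Fin 3 → Prop}
  {π : Fin 3 → Fin 2}

lemma Quo.closed3 (hq : Quo C D π) (hm : Mal C m) {x y z : Fin 3} (hx : D x) (hy : D y) (hz : D z) :
    D (m ![x, y, z]) := by
  apply hq.closed 2 m hm.1
  intro l
  fin_cases l <;> simpa

lemma Quo.comp3 (hq : Quo C D π) (hm : Mal C m) {x y z x' y' z' : Fin 3} (hx : D x) (hy : D y)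
    (hz : D z) (hx' : D x') (hy' : D y') (hz' : D z') (h1 : π x = π x') (h2 : π y = π y')
    (h3 : π z = π z') : π (m ![x, y, z]) = π (m ![x', y', z']) := by
  apply hq.comp 2 m hm.1
  · intro l
    fin_cases l <;> simpa
  · intro l
    fin_cases l <;> simpa
  · intro l
    fin_cases l <;> simpa

/-- If every Mal'cev operation is bad at `(t,a)`, then `m` is the minority modulo `π`. -/
lemma Quo.mino (hC : IsClone C) (hm : Mal C m) (hq : Quo C D π) {t a : Fin 3} (ht : D t) (ha : D a)
    (ht0 : π t = 0) (ha1 : π a = 1) (hbad : ∀ s, Mal C s → π (s ![t, a, t]) = 1) :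
    ∀ x y z, D x → D y → D z → D (m ![x, y, z]) ∧ π (m ![x, y, z]) = π x + π y + π z := by
  let rep : Fin 2 → Fin 3 := ![t, a]
  have hrep : ∀ i, D (rep i) := by intro i; fin_cases i <;> simpa [rep]
  have hrepπ : ∀ i, π (rep i) = i := by intro i; fin_cases i <;> simpa [rep]
  let M : Fin 2 → Fin 2 → Fin 2 → Fin 2 := fun i j k => π (m ![rep i, rep j, rep k])
  have hM : ∀ x y z, D x → D y → D z → π (m ![x, y, z]) = M (π x) (π y) (π z) := by
    intro x y z hx hy hz
    exact hq.comp3 hm hx hy hz (hrep _) (hrep _) (hrep _) (hrepπ _).symm (hrepπ _).symm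
      (hrepπ _).symm
  have hM1 : ∀ i j, M i j j = i := fun i j => by
    simp only [M, (hm.2 _ _).1, hrepπ]
  have hM2 : ∀ i j, M j j i = i := fun i j => by
    simp only [M, (hm.2 _ _).2, hrepπ]
  have h010 : M 0 1 0 = 1 := hbad m hm
  have h101 : M 1 0 1 = 0 := by
    by_contra hne
    have h101 : M 1 0 1 = 1 := by
      revert hne
      generalize M 1 0 1 = q
      revert q
      decide
    let μ : Fin 3 → Fin 3 → Fin 3 → Fin 3 := fun x y z => m ![x, y, z]
    let f : Fin 3 → Fin 3 → Fin 3 := fun x y => μ x (μ x (μ x y x) x) y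
    have hf : ∀ (p q : (Fin (2 + 1) → Fin 3) → Fin 3), p ∈ C 2 → q ∈ C 2 →
        (fun v => f (p v) (q v)) ∈ C 2 := fun p q hp hq =>
      _root_.comp3 hC hm.1 hp (_root_.comp3 hC hm.1 hp (_root_.comp3 hC hm.1 hp hq hp) hp) hq
    have p0 := hC.proj 2 0
    have p1 := hC.proj 2 1
    have p2 := hC.proj 2 2
    let s : (Fin (2 + 1) → Fin 3) → Fin 3 := fun v =>
      μ (μ (v 0) (v 1) (v 2)) (μ (f (v 0) (v 2)) (f (v 1) (v 2)) (f (v 1) (v 1))) (f (v 0) (v 1))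
    have hs : s ∈ C 2 := _root_.comp3 hC hm.1 (_root_.comp3 hC hm.1 p0 p1 p2)
      (_root_.comp3 hC hm.1 (hf _ _ p0 p2) (hf _ _ p1 p2) (hf _ _ p1 p1)) (hf _ _ p0 p1)
    have μ1 : ∀ x y, μ y x x = y := fun x y => (hm.2 x y).1
    have μ2 : ∀ x y, μ x x y = y := fun x y => (hm.2 x y).2
    have hsm : Mal C s := by
      refine ⟨hs, fun x y => ⟨?_, ?_⟩⟩
      · simp [s, μ1, μ2]
      · simp [s, μ1, μ2]
    have hb := hbad s hsm
    have hD : ∀ x y z, D x → D y → D z → D (μ x y z) := fun x y z hx hy hz => hq.closed3 hm hx hy hz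
    have hfD : ∀ x y, D x → D y → D (f x y) := fun x y hx hy =>
      hD _ _ _ hx (hD _ _ _ hx (hD _ _ _ hx hy hx) hx) hy
    have hM' : ∀ x y z, D x → D y → D z → π (μ x y z) = M (π x) (π y) (π z) := hM
    have hfπ : ∀ x y, D x → D y → π (f x y) = M (π x) (M (π x) (M (π x) (π y) (π x)) (π x)) (π y) := by
      intro x y hx hy
      simp only [f]
      rw [hM' _ _ _ hx (hD _ _ _ hx (hD _ _ _ hx hy hx) hx) hy, hM' _ _ _ hx (hD _ _ _ hx hy hx) hx,
        hM' _ _ _ hx hy hx]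
    have hst : s ![t, a, t] = μ (μ t a t) (μ (f t t) (f a t) (f a a)) (f t a) := rfl
    rw [hst, hM' _ _ _ (hD _ _ _ ht ha ht) (hD _ _ _ (hfD _ _ ht ht) (hfD _ _ ha ht) (hfD _ _ ha ha))
      (hfD _ _ ht ha), hM' _ _ _ ht ha ht, hM' _ _ _ (hfD _ _ ht ht) (hfD _ _ ha ht) (hfD _ _ ha ha),
      hfπ _ _ ht ht, hfπ _ _ ha ht, hfπ _ _ ha ha, hfπ _ _ ht ha] at hb
    simp [ht0, ha1, h010, h101, hM1, hM2] at hb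
  intro x y z hx hy hz
  refine ⟨hq.closed3 hm hx hy hz, ?_⟩
  rw [hM x y z hx hy hz]
  have : ∀ i j k, M i j k = i + j + k := by
    intro i j k
    fin_cases i <;> fin_cases j <;> fin_cases k <;> simp [hM1, hM2, h010, h101]
  exact this _ _ _

/-- If every Mal'cev operation is bad at `(t,a)`, then all operations are affine modulo `π`. -/
lemma Quo.affine (hC : IsClone C) (hid : Idem C) (hm : Mal C m) (hq : Quo C D π) {t a : Fin 3}
    (ht : D t) (ha : D a)
    (ht0 : π t = 0) (ha1 : π a = 1) (hbad : ∀ s, Mal C s → π (s ![t, a, t]) = 1)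
    {f : (Fin (n + 1) → Fin 3) → Fin 3} (hf : f ∈ C n) {z1 z2 z3 z4 : Fin (n + 1) → Fin 3}
    (h1 : ∀ l, D (z1 l)) (h2 : ∀ l, D (z2 l)) (h3 : ∀ l, D (z3 l)) (h4 : ∀ l, D (z4 l))
    (hz : ∀ l, π (z4 l) = π (z1 l) + π (z2 l) + π (z3 l)) :
    π (f z4) = π (f z1) + π (f z2) + π (f z3) := by
  have hmin := hq.mino hC hm ht ha ht0 ha1 hbad
  -- four ternary terms for each argument
  have hg : ∀ l, ∃ g1 ∈ C 2, ∃ g2 ∈ C 2, ∃ g3 ∈ C 2, ∃ g4 ∈ C 2,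
      (∀ x y, g1 ![x, x, y] = g2 ![x, x, y] ∧ g3 ![x, x, y] = g4 ![x, x, y]) ∧
      (∀ x y, g1 ![y, x, x] = g3 ![y, x, x] ∧ g2 ![y, x, x] = g4 ![y, x, x]) ∧
      (D (g1 ![t, a, t]) ∧ π (g1 ![t, a, t]) = π (z1 l)) ∧
      (D (g2 ![t, a, t]) ∧ π (g2 ![t, a, t]) = π (z2 l)) ∧
      (D (g3 ![t, a, t]) ∧ π (g3 ![t, a, t]) = π (z3 l)) ∧
      (D (g4 ![t, a, t]) ∧ π (g4 ![t, a, t]) = π (z4 l)) := by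
    intro l
    have p0 := hC.proj 2 0
    have p1 := hC.proj 2 1
    have p2 := hC.proj 2 2
    have hmt : D (m ![t, a, t]) ∧ π (m ![t, a, t]) = 1 := by
      have := hmin t a t ht ha ht
      simpa [ht0, ha1] using this
    have e : ∀ q : Fin 2, q = 0 ∨ q = 1 := by decide
    rw [hz l]
    rcases e (π (z1 l)) with e1 | e1 <;> rcases e (π (z2 l)) with e2 | e2 <;>
      rcases e (π (z3 l)) with e3 | e3 <;> rw [e1, e2, e3]
    · exact ⟨_, p0, _, p0, _, p0, _, p0, by simp, by simp, by simp [*], by simp [*], by simp [*], by simp [*]⟩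
    · exact ⟨_, p2, _, p2, _, p1, _, p1, by simp, by simp, by simp [*], by simp [*], by simp [*], by simp [*]⟩
    · exact ⟨_, p0, _, p1, _, p0, _, p1, by simp, by simp, by simp [*], by simp [*], by simp [*], by simp [*]⟩
    · refine ⟨_, p2, m, hm.1, _, p1, _, p0, ?_, ?_, by simp [*], by simp [*], by simp [*], by simp [*]⟩
      · intro x y; simp [(hm.2 _ _).2]
      · intro x y; simp [(hm.2 _ _).1]
    · refine ⟨m, hm.1, _, p2, _, p0, _, p1, ?_, ?_, by simp [*], by simp [*], by simp [*], by simp [*]⟩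
      · intro x y; simp [(hm.2 _ _).2]
      · intro x y; simp [(hm.2 _ _).1]
    · exact ⟨_, p1, _, p0, _, p1, _, p0, by simp, by simp, by simp [*], by simp [*], by simp [*], by simp [*]⟩
    · exact ⟨_, p1, _, p1, _, p2, _, p2, by simp, by simp, by simp [*], by simp [*], by simp [*], by simp [*]⟩
    · exact ⟨_, p1, _, p1, _, p1, _, p1, by simp, by simp, by simp [*], by simp [*], by simp [*], by simp [*]⟩
  choose g1 hg1 g2 hg2 g3 hg3 g4 hg4 hJ hK hp1 hp2 hp3 hp4 using hg
  have F1 := hC.comp n 2 f g1 hf hg1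
  have F2 := hC.comp n 2 f g2 hf hg2
  have F3 := hC.comp n 2 f g3 hf hg3
  have F4 := hC.comp n 2 f g4 hf hg4
  have hs := _root_.comp3 hC hm.1 hm.1 (_root_.comp3 hC hm.1 F1 F2 F4) F3
  have hsm : Mal C (fun x => m ![m x, m ![f fun i => g1 i x, f fun i => g2 i x, f fun i => g4 i x],
      f fun i => g3 i x]) := by
    refine ⟨hs, fun x y => ⟨?_, ?_⟩⟩
    · simp only [(hK _ x y).1, (hK _ x y).2, (hm.2 _ _).1, (hm.2 _ _).2]
    · simp only [(hJ _ x y).1, (hJ _ x y).2, (hm.2 _ _).1, (hm.2 _ _).2]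
  have hb := hbad _ hsm
  have D1 := hq.closed n f hf (fun i => g1 i ![t, a, t]) (fun i => (hp1 i).1)
  have D2 := hq.closed n f hf (fun i => g2 i ![t, a, t]) (fun i => (hp2 i).1)
  have D3 := hq.closed n f hf (fun i => g3 i ![t, a, t]) (fun i => (hp3 i).1)
  have D4 := hq.closed n f hf (fun i => g4 i ![t, a, t]) (fun i => (hp4 i).1)
  have E1 := hq.comp n f hf _ _ (fun i => (hp1 i).1) h1 (fun i => (hp1 i).2)
  have E2 := hq.comp n f hf _ _ (fun i => (hp2 i).1) h2 (fun i => (hp2 i).2)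
  have E3 := hq.comp n f hf _ _ (fun i => (hp3 i).1) h3 (fun i => (hp3 i).2)
  have E4 := hq.comp n f hf _ _ (fun i => (hp4 i).1) h4 (fun i => (hp4 i).2)
  rw [(hmin _ _ _ (hmin t a t ht ha ht).1 (hmin _ _ _ D1 D2 D4).1 D3).2, (hmin t a t ht ha ht).2,
    (hmin _ _ _ D1 D2 D4).2, E1, E2, E3, E4, ht0, ha1] at hb
  revert hb
  generalize π (f z1) = b1
  generalize π (f z2) = b2
  generalize π (f z3) = b3
  generalize π (f z4) = b4
  revert b1 b2 b3 b4
  decide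

/-- Odd sums. -/
lemma exists_sum (hC : IsClone C) (hm : Mal C m) (k : ℕ) :
    ∀ S : Finset (Fin (n + 1)), S.card = 2 * k + 1 → ∃ F ∈ C n, ∀ (D : Fin 3 → Prop)
      (π : Fin 3 → Fin 2), (∀ x y z, D x → D y → D z →
        D (m ![x, y, z]) ∧ π (m ![x, y, z]) = π x + π y + π z) →
      ∀ x : Fin (n + 1) → Fin 3, (∀ l ∈ S, D (x l)) →
        D (F x) ∧ π (F x) = ∑ l ∈ S, π (x l) := by
  induction k with
  | zero =>
    intro S hS
    obtain ⟨l, rfl⟩ := Finset.card_eq_one.1 (by simpa using hS)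
    refine ⟨_, hC.proj n l, fun D π _ x hx => ⟨hx l (by simp), by simp⟩⟩
  | succ k ih =>
    intro S hS
    obtain ⟨i, S1, hi, rfl, hS1⟩ := Finset.card_eq_succ.1 (show S.card = (2 * k + 2) + 1 by omega)
    obtain ⟨j, S2, hj, rfl, hS2⟩ := Finset.card_eq_succ.1 (show S1.card = (2 * k + 1) + 1 by omega)
    obtain ⟨F, hF, hF2⟩ := ih S2 hS2
    refine ⟨_, comp3 hC hm.1 (hC.proj n i) (hC.proj n j) hF, fun D π hD x hx => ?_⟩
    have h1 := hF2 D π hD x (fun l hl => hx l (by simp [hl]))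
    have h2 := hD (x i) (x j) (F x) (hx i (by simp)) (hx j (by simp)) h1.1
    refine ⟨h2.1, ?_⟩
    rw [h2.2, h1.2, Finset.sum_insert hi, Finset.sum_insert hj, add_assoc]

end

/-! ## Critical sets of points -/

/-- Some operation of `C` agrees with `T` on `I`. -/
def Interp (C : Ops (Fin 3)) (n : ℕ) (T : (Fin (n + 1) → Fin 3) → Fin 3)
    (I : Finset (Fin (n + 1) → Fin 3)) : Prop := ∃ f ∈ C n, ∀ y ∈ I, f y = T y

/-- `I` is a minimal set of points on which `T` cannot be interpolated. -/
structure Crit (C : Ops (Fin 3)) (n : ℕ) (T : (Fin (n + 1) → Fin 3) → Fin 3)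
    (I : Finset (Fin (n + 1) → Fin 3)) : Prop where
  not_interp : ¬ Interp C n T I
  erase : ∀ i ∈ I, Interp C n T (I.erase i)

/-- The fork relation at `i` relative to the other points of `I`. -/
abbrev Gam (C : Ops (Fin 3)) (n : ℕ) (I : Finset (Fin (n + 1) → Fin 3))
    (i : Fin (n + 1) → Fin 3) : Fin 3 → Fin 3 → Prop := Fork C n {y | y ∈ I ∧ y ≠ i} i

section
variable {C : Ops (Fin 3)} {n : ℕ} {m : (Fin (2 + 1) → Fin 3) → Fin 3}
  {T : (Fin (n + 1) → Fin 3) → Fin 3} {I : Finset (Fin (n + 1) → Fin 3)}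

lemma exists_crit : ∀ I0 : Finset (Fin (n + 1) → Fin 3), ¬ Interp C n T I0 →
    ∃ I, I ⊆ I0 ∧ Crit C n T I := by
  intro I0
  induction I0 using Finset.strongInduction with
  | H I0 ih =>
    intro h
    by_cases h2 : ∀ i ∈ I0, Interp C n T (I0.erase i)
    · exact ⟨I0, Finset.Subset.refl _, h, h2⟩
    · push Not at h2
      obtain ⟨i, hi, h3⟩ := h2
      obtain ⟨I, hI, hc⟩ := ih _ (Finset.erase_ssubset hi) h3
      exact ⟨I, hI.trans (Finset.erase_subset _ _), hc⟩

lemma Crit.wit (hc : Crit C n T I) {i : Fin (n + 1) → Fin 3} (hi : i ∈ I) :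
    ∃ w ∈ C n, (∀ y ∈ I, y ≠ i → w y = T y) ∧ w i ≠ T i := by
  obtain ⟨w, hw, h⟩ := hc.erase i hi
  refine ⟨w, hw, fun y hy hne => h y (Finset.mem_erase.2 ⟨hne, hy⟩), fun h2 => ?_⟩
  refine hc.not_interp ⟨w, hw, fun y hy => ?_⟩
  by_cases hyi : y = i
  · rw [hyi, h2]
  · exact h y (Finset.mem_erase.2 ⟨hyi, hy⟩)

lemma adjust (hC : IsClone C) (hm : Mal C m) {r : (Fin (n + 1) → Fin 3) → Fin 3} (hr : r ∈ C n)
    (h : ∀ i ∈ I, Gam C n I i (r i) (T i)) : Interp C n T I := by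
  have : ∀ I' : Finset (Fin (n + 1) → Fin 3), I' ⊆ I → ∃ s ∈ C n, (∀ y ∈ I', s y = T y) ∧
      ∀ y ∈ I, y ∉ I' → s y = r y := by
    intro I'
    induction I' using Finset.induction_on with
    | empty => exact fun _ => ⟨r, hr, by simp, fun _ _ _ => rfl⟩
    | insert i I' hi ih =>
      intro hsub
      obtain ⟨s, hs, h1, h2⟩ := ih (fun y hy => hsub (Finset.mem_insert_of_mem hy))
      have hiI : i ∈ I := hsub (Finset.mem_insert_self _ _)
      obtain ⟨s', hs', h3, h4⟩ := (h i hiI).shift hC hm hs (h2 i hiI hi)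
      refine ⟨s', hs', ?_, ?_⟩
      · intro y hy
        rcases Finset.mem_insert.1 hy with rfl | hy
        · exact h4
        · have hne : y ≠ i := fun h => hi (h ▸ hy)
          rw [h3 y ⟨hsub (Finset.mem_insert_of_mem hy), hne⟩, h1 y hy]
      · intro y hy hn
        rw [Finset.mem_insert, not_or] at hn
        rw [h3 y ⟨hy, hn.1⟩, h2 y hy hn.2]
  obtain ⟨s, hs, h1, -⟩ := this I (Finset.Subset.refl _)
  exact ⟨s, hs, h1⟩

lemma Crit.not_gam (hC : IsClone C) (hm : Mal C m) (hc : Crit C n T I) {i : Fin (n + 1) → Fin 3}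
    {w : (Fin (n + 1) → Fin 3) → Fin 3} (hw : w ∈ C n)
    (hwi : ∀ y ∈ I, y ≠ i → w y = T y) : ¬ Gam C n I i (w i) (T i) := by
  intro h
  obtain ⟨s, hs, h1, h2⟩ := h.shift hC hm hw rfl
  refine hc.not_interp ⟨s, hs, fun y hy => ?_⟩
  by_cases hyi : y = i
  · rw [hyi, h2]
  · rw [h1 y ⟨hy, hyi⟩, hwi y hy hyi]

lemma Crit.bad (hC : IsClone C) (hc : Crit C n T I)
    {i j k : Fin (n + 1) → Fin 3} (hj : j ∈ I) (hk : k ∈ I) (hij : i ≠ j)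
    (hik : i ≠ k) (hjk : j ≠ k) {w : (Fin (n + 1) → Fin 3) → Fin 3} (hw : w ∈ C n)
    (hwi : ∀ y ∈ I, y ≠ i → w y = T y) {s : (Fin (2 + 1) → Fin 3) → Fin 3} (hs : Mal C s) :
    ¬ Gam C n I i (s ![T i, w i, T i]) (T i) := by
  intro h
  by_cases hi : i ∈ I
  swap
  · exact hc.not_interp ⟨w, hw, fun y hy => hwi y hy (fun h => hi (h ▸ hy))⟩
  obtain ⟨wj, hwj, hj1, -⟩ := hc.wit hj
  obtain ⟨wk, hwk, hk1, -⟩ := hc.wit hk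
  obtain ⟨v, hv, h1, h2⟩ := h.shift hC hs (comp3 hC hs.1 hwj hw hwk)
    (by simp only [hj1 i hi hij, hk1 i hi hik])
  refine hc.not_interp ⟨_, comp3 hC hs.1 hwj hv hwk, fun y hy => ?_⟩
  by_cases hyi : y = i
  · subst hyi
    simp only [h2, hj1 y hi hij, hk1 y hi hik, (hs.2 _ _).1]
  · simp only [h1 y ⟨hy, hyi⟩, hwi y hy hyi]
    by_cases hyj : y = j
    · subst hyj
      simp only [hk1 y hy hjk, (hs.2 _ _).1, (hs.2 _ _).2]
    · simp only [hj1 y hy hyj, (hs.2 _ _).1, (hs.2 _ _).2]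

/-- No majority operation yields a bad pair. -/
lemma exists_bad (hC : IsClone C) (hm : Mal C m)
    (hnomaj : ¬ ∃ m ∈ C 2, ∀ x y : Fin 3,
      m ![x, x, y] = x ∧ m ![x, y, x] = x ∧ m ![y, x, x] = x) :
    ∃ t a : Fin 3, ∀ s, Mal C s → s ![t, a, t] ≠ t := by
  let T : (Fin (2 + 1) → Fin 3) → Fin 3 := fun v => if v 0 = v 1 then v 0 else
    if v 0 = v 2 then v 0 else v 1
  let I0 : Finset (Fin (2 + 1) → Fin 3) :=
    Finset.univ.filter fun v => v 0 = v 1 ∨ v 0 = v 2 ∨ v 1 = v 2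
  have hT : ∀ v ∈ I0, (v 0 = T v ∧ v 1 = T v) ∨ (v 0 = T v ∧ v 2 = T v) ∨ (v 1 = T v ∧ v 2 = T v) := by
    intro v hv
    simp only [I0, Finset.mem_filter, Finset.mem_univ, true_and] at hv
    simp only [T]
    split_ifs <;> grind
  have hn : ¬ Interp C 2 T I0 := by
    rintro ⟨f, hf, h⟩
    refine hnomaj ⟨f, hf, fun x y => ⟨?_, ?_, ?_⟩⟩
    · rw [h _ (by simp [I0])]; simp [T]
    · rw [h _ (by simp [I0])]; simp [T]
    · rw [h _ (by simp [I0])]; by_cases hxy : y = x <;> simp [T, hxy]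
  obtain ⟨I, hI, hc⟩ := exists_crit I0 hn
  have hcard : 2 < I.card := by
    by_contra hle
    have hle : I.card ≤ 2 := by omega
    have hpq : ∃ p q, p ∈ I0 ∧ q ∈ I0 ∧ I ⊆ {p, q} := by
      have hz : (fun _ => 0 : Fin (2 + 1) → Fin 3) ∈ I0 := by simp [I0]
      interval_cases hcd : I.card
      · exact ⟨_, _, hz, hz, by rw [Finset.card_eq_zero.1 hcd]; simp⟩
      · obtain ⟨p, rfl⟩ := Finset.card_eq_one.1 hcd
        exact ⟨p, p, hI (by simp), hI (by simp), by simp⟩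
      · obtain ⟨p, q, -, rfl⟩ := Finset.card_eq_two.1 hcd
        exact ⟨p, q, hI (by simp), hI (by simp), by simp⟩
    obtain ⟨p, q, hp, hq, hsub⟩ := hpq
    have : ∃ l : Fin (2 + 1), p l = T p ∧ q l = T q := by
      rcases hT p hp with h | h | h <;> rcases hT q hq with h' | h' | h' <;>
        first
        | exact ⟨0, by tauto⟩
        | exact ⟨1, by tauto⟩
        | exact ⟨2, by tauto⟩
    obtain ⟨l, hl1, hl2⟩ := this
    refine hc.not_interp ⟨_, hC.proj 2 l, fun y hy => ?_⟩
    have := hsub hy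
    simp only [Finset.mem_insert, Finset.mem_singleton] at this
    rcases this with rfl | rfl <;> assumption
  obtain ⟨i, j, k, hi, hj, hk, hij, hik, hjk⟩ := Finset.two_lt_card_iff.1 hcard
  obtain ⟨w, hw, h1, h2⟩ := hc.wit hi
  refine ⟨T i, w i, fun s hs h => hc.bad hC hj hk hij hik hjk hw h1 hs ?_⟩
  rw [h]
  rcases hT i (hI hi) with ⟨h, -⟩ | ⟨h, -⟩ | ⟨h, -⟩
  · simpa only [h] using Fork.refl (J := {y | y ∈ I ∧ y ≠ i}) (x := i) (hC.proj 2 0)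
  · simpa only [h] using Fork.refl (J := {y | y ∈ I ∧ y ≠ i}) (x := i) (hC.proj 2 0)
  · simpa only [h] using Fork.refl (J := {y | y ∈ I ∧ y ≠ i}) (x := i) (hC.proj 2 1)

open Classical in
/-- The quotient attached to a two-class fork relation. -/
lemma quo_of_fork (hC : IsClone C) (hm : Mal C m) {J : Set (Fin (n + 1) → Fin 3)}
    {x : Fin (n + 1) → Fin 3} {t a : Fin 3}
    (h2 : ∀ f ∈ C n, Fork C n J x (f x) t ∨ Fork C n J x (f x) a) :
    Quo C (fun u => ∃ f ∈ C n, f x = u) (fun u => if Fork C n J x u t then 0 else 1) := by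
  constructor
  · intro k f hf z hz
    choose g hg hgx using hz
    exact ⟨_, hC.comp k n f g hf hg, by simp only [hgx]⟩
  · intro k f hf y z hy hz hyz
    have hE : ∀ l, Fork C n J x (y l) (z l) := by
      intro l
      obtain ⟨g, hg, hgy⟩ := hy l
      obtain ⟨g', hg', hgz⟩ := hz l
      have h3 := h2 g hg
      have h4 := h2 g' hg'
      rw [hgy] at h3
      rw [hgz] at h4
      have h5 := hyz l
      by_cases c1 : Fork C n J x (y l) t
      · by_cases c2 : Fork C n J x (z l) t
        · exact c1.trans hC hm c2.symm
        · simp [c1, c2] at h5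
      · by_cases c2 : Fork C n J x (z l) t
        · simp [c1, c2] at h5
        · exact (h3.resolve_left c1).trans hC hm (h4.resolve_left c2).symm
    have h6 : Fork C n J x (f y) (f z) := Fork.compat hC hf hE
    have h7 : Fork C n J x (f y) t ↔ Fork C n J x (f z) t :=
      ⟨fun h => h6.symm.trans hC hm h, fun h => h6.trans hC hm h⟩
    simp only [h7]

open Classical in
/-- First half: a minion homomorphism to `𝒵₂`. -/
lemma to_Z2 (hC : IsClone C) (hid : Idem C) (hm : Mal C m)
    (hphi : ¬ ∀ n, ∀ f ∈ C n, Preserves f phi) {t a : Fin 3}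
    (hbad : ∀ s, Mal C s → s ![t, a, t] ≠ t) : MinorLE C CloneZ2 := by
  let x : Fin (2 + 1) → Fin 3 := ![t, a, t]
  let J : Set (Fin (2 + 1) → Fin 3) := {v | v 0 = v 1}
  let K : Set (Fin (2 + 1) → Fin 3) := {v | v 1 = v 2}
  have hJ : ∀ u v : Fin 3, ![u, u, v] ∈ J := fun u v => by simp [J]
  have hK : ∀ u v : Fin 3, ![v, u, u] ∈ K := fun u v => by simp [K]
  have p0 := hC.proj 2 0
  have p1 := hC.proj 2 1
  have p2 := hC.proj 2 2
  have et : ∀ J, Fork C 2 J x t t := fun J => Fork.refl (J := J) (x := x) p0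
  have ea : ∀ J, Fork C 2 J x a a := fun J => Fork.refl (J := J) (x := x) p1
  have hbad' : ∀ s, Mal C s → ¬ Fork C 2 (J ∪ K) x (s x) t := by
    intro s hs h
    obtain ⟨s', hs', h1, h2⟩ := h.shift hC hm hs.1 rfl
    refine hbad s' ⟨hs', fun u v => ⟨?_, ?_⟩⟩ h2
    · rw [h1 _ (Or.inr (hK u v))]; exact (hs.2 _ _).1
    · rw [h1 _ (Or.inl (hJ u v))]; exact (hs.2 _ _).2
  have hta : ¬ Fork C 2 (J ∪ K) x a t := by
    intro h
    apply hbad' m hm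
    have : Fork C 2 (J ∪ K) x (m ![t, a, t]) (m ![t, t, t]) := by
      apply Fork.compat hC hm.1
      intro i
      fin_cases i
      · exact et _
      · exact h
      · exact et _
    rwa [(hm.2 _ _).1] at this
  by_cases h2 : ∀ f ∈ C 2, Fork C 2 (J ∪ K) x (f x) t ∨ Fork C 2 (J ∪ K) x (f x) a
  · have hq := quo_of_fork hC hm h2
    set π : Fin 3 → Fin 2 := fun u => if Fork C 2 (J ∪ K) x u t then 0 else 1 with hπ
    have ht0 : π t = 0 := if_pos (et _)
    have ha1 : π a = 1 := if_neg hta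
    have hDt : ∃ f ∈ C 2, f x = t := ⟨_, p0, rfl⟩
    have hDa : ∃ f ∈ C 2, f x = a := ⟨_, p1, rfl⟩
    let ρ : Fin 2 → Fin 3 := ![t, a]
    have hρD : ∀ i, ∃ f ∈ C 2, f x = ρ i := by
      intro i; fin_cases i
      · exact hDt
      · exact hDa
    have hρπ : ∀ i, π (ρ i) = i := by
      intro i; fin_cases i
      · exact ht0
      · exact ha1
    refine ⟨fun n f y => π (f fun l => ρ (y l)), ?_, ?_⟩
    · intro n f hf
      refine ⟨?_, ?_, ?_⟩
      · intro r hr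
        refine hq.affine hC hid hm hDt hDa ht0 ha1 (fun s hs => if_neg (hbad' s hs)) hf
          (fun l => hρD _) (fun l => hρD _) (fun l => hρD _) (fun l => hρD _) ?_
        intro l
        simp only [hρπ]
        exact hr l
      · intro r hr
        have hr' : ∀ i, r i 0 = 0 := hr
        change π (f fun l => ρ (r l 0)) = 0
        simp only [hr']
        rw [hid n f hf, hρπ]
      · intro r hr
        have hr' : ∀ i, r i 0 = 1 := hr
        change π (f fun l => ρ (r l 0)) = 1
        simp only [hr']
        rw [hid n f hf, hρπ]
    · intro n r f σ hf
      rfl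
  · exfalso
    push Not at h2
    obtain ⟨f, hf, h3, h4⟩ := h2
    obtain ⟨hall, heq⟩ := three_classes (E := Fork C 2 (J ∪ K) x) (fun u v h => h.symm)
      (fun h => hta h.symm) h3 h4 (et _) (ea _)
    have hD : ∀ u, ∃ f ∈ C 2, f x = u := by
      intro u
      rcases hall u with rfl | rfl | rfl
      · exact ⟨_, p0, rfl⟩
      · exact ⟨_, p1, rfl⟩
      · exact ⟨f, hf, rfl⟩
    refine hphi (abelian_phi hC hid hm a (J := J) (K := K) (x := x) ?_ ?_ heq)
    · intro u
      obtain ⟨p, hp, hpx⟩ := hD u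
      refine ⟨_, p1, _, comp3 hC hp p0 p1 p0, ?_, rfl, hpx⟩
      intro v hv
      have hv : v 0 = v 1 := hv
      have : (![v 0, v 1, v 0] : Fin (2 + 1) → Fin 3) = fun _ => v 1 := by
        funext i; fin_cases i <;> simp [hv]
      rw [this, hid _ _ hp]
    · intro u
      obtain ⟨p, hp, hpx⟩ := hD u
      refine ⟨_, p1, _, comp3 hC hp p2 p1 p2, ?_, rfl, hpx⟩
      intro v hv
      have hv : v 1 = v 2 := hv
      have : (![v 2, v 1, v 2] : Fin (2 + 1) → Fin 3) = fun _ => v 1 := by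
        funext i; fin_cases i <;> simp [hv]
      rw [this, hid _ _ hp]

end

/-! ## Congruences, automorphisms and the distinguished element -/

/-- The partition with the singleton class `c` is a congruence. -/
def ThC (C : Ops (Fin 3)) (c : Fin 3) : Prop :=
  ∀ n, ∀ f ∈ C n, ∀ x y : Fin (n + 1) → Fin 3, (∀ l, x l = c ↔ y l = c) → (f x = c ↔ f y = c)

/-- `σ` is an automorphism of `C`. -/
def Auto (C : Ops (Fin 3)) (σ : Fin 3 → Fin 3) : Prop :=
  Function.Injective σ ∧ ∀ n, ∀ f ∈ C n, ∀ x, f (fun l => σ (x l)) = σ (f x)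

/-- The distinguished element. -/
structure Good (C : Ops (Fin 3)) (c : Fin 3) : Prop where
  th : ∀ c', ThC C c' → c' = c
  au : ∀ σ, Auto C σ → σ c = c

section
variable {C : Ops (Fin 3)} {n : ℕ} {m : (Fin (2 + 1) → Fin 3) → Fin 3} {c c' : Fin 3}

lemma ThC.m_eq (hm : Mal C m) (h : ThC C c) {e d : Fin 3} (he : e ≠ c) (hd : d ≠ c) :
    m ![c, e, d] = c := by
  refine (h 2 m hm.1 ![c, e, d] ![c, e, e] ?_).2 (hm.2 _ _).1
  intro l
  fin_cases l <;> simp [he, hd]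

lemma ThC.m_eq' (hm : Mal C m) (h : ThC C c) {e d : Fin 3} (he : e ≠ c) (hd : d ≠ c) :
    m ![d, e, c] = c := by
  refine (h 2 m hm.1 ![d, e, c] ![e, e, c] ?_).2 (hm.2 _ _).2
  intro l
  fin_cases l <;> simp [he, hd]

lemma ThC.unique (hm : Mal C m) (h : ThC C c) (h' : ThC C c') : c = c' := by
  by_contra hne
  obtain ⟨e, he, he'⟩ : ∃ e, e ≠ c ∧ e ≠ c' := by
    clear * -
    revert c c'
    decide
  have h1 := h.m_eq hm he (Ne.symm hne)
  have h2 := h'.m_eq' hm he' hne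
  exact hne (h1.symm.trans h2)

lemma thc_of_equiv {E : Fin 3 → Fin 3 → Prop} (hr : ∀ u, E u u) (hs : ∀ u v, E u v → E v u)
    (ht : ∀ u v w, E u v → E v w → E u w)
    (hcomp : ∀ k, ∀ h ∈ C k, ∀ a b : Fin (k + 1) → Fin 3, (∀ i, E (a i) (b i)) → E (h a) (h b))
    (h1 : ∃ p q, E p q ∧ p ≠ q) (h2 : ∃ p q, ¬ E p q) :
    ∃ c', ThC C c' ∧ ∀ u v, E u v ↔ (u = c' ↔ v = c') := by
  obtain ⟨p, q, hpq, hne⟩ := h1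
  obtain ⟨c', hc1, hc2, hall⟩ : ∃ c', c' ≠ p ∧ c' ≠ q ∧ ∀ v, v = p ∨ v = q ∨ v = c' := by
    clear * - hne
    revert p q
    decide
  have hpc : ¬ E p c' := by
    intro hpc
    obtain ⟨r, s, hrs⟩ := h2
    have hp : ∀ v, E p v := by
      intro v
      rcases hall v with rfl | rfl | rfl
      · exact hr _
      · exact hpq
      · exact hpc
    exact hrs (ht _ _ _ (hs _ _ (hp r)) (hp s))
  have hE : ∀ u v, E u v ↔ (u = c' ↔ v = c') := by
    have hqc : ¬ E q c' := fun h => hpc (ht _ _ _ hpq h)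
    intro u v
    rcases hall u with rfl | rfl | rfl <;> rcases hall v with rfl | rfl | rfl <;>
      grind
  refine ⟨c', ?_, hE⟩
  intro k f hf x y hxy
  exact (hE _ _).1 (hcomp k f hf x y fun l => (hE _ _).2 (hxy l))

lemma exists_good (hm : Mal C m) (hphi : ¬ ∀ n, ∀ f ∈ C n, Preserves f phi) :
    ∃ c, Good C c := by
  have hfix : ∀ σ, Auto C σ → ∃ z, σ z = z := by
    intro σ hσ
    by_contra h
    push Not at h
    exact hphi (phi_of_comm hσ.1 h hσ.2)
  by_cases h1 : ∃ c, ThC C c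
  · obtain ⟨c, hc⟩ := h1
    refine ⟨c, fun c' hc' => hc'.unique hm hc, fun σ hσ => ?_⟩
    refine ThC.unique hm ?_ hc
    intro k f hf x y hxy
    obtain ⟨τ, hτ⟩ := (Finite.injective_iff_bijective.1 hσ.1).surjective.hasRightInverse
    have hx : ∀ z : Fin (k + 1) → Fin 3, f z = σ (f fun l => τ (z l)) := by
      intro z
      rw [← hσ.2 k f hf]
      congr 1
      funext l
      exact (hτ _).symm
    rw [hx x, hx y, hσ.1.eq_iff, hσ.1.eq_iff]
    apply hc k f hf
    intro l
    rw [← hσ.1.eq_iff (b := c), ← hσ.1.eq_iff (b := c), hτ, hτ]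
    exact hxy l
  by_cases h2 : ∃ σ, Auto C σ ∧ ∃ z, σ z ≠ z
  · obtain ⟨σ, hσ, z, hz⟩ := h2
    obtain ⟨c, hc⟩ := hfix σ hσ
    refine ⟨c, fun c' hc' => absurd ⟨c', hc'⟩ h1, fun τ hτ => ?_⟩
    by_contra hne
    have hcomp : Auto C (fun u => τ (σ u)) := by
      refine ⟨hτ.1.comp hσ.1, fun k f hf x => ?_⟩
      rw [hτ.2 k f hf (fun l => σ (x l)), hσ.2 k f hf]
    obtain ⟨z1, hz1⟩ := hfix τ hτ
    obtain ⟨z2, hz2⟩ := hfix _ hcomp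
    have key : ∀ s t : Fin 3 → Fin 3, Function.Injective s → Function.Injective t → ∀ c z z1 z2,
        s z ≠ z → s c = c → t c ≠ c → t z1 = z1 → t (s z2) = z2 → False := by
      clear * -
      intro s t hs ht c z z1 z2 h1 h2 h3 h4 h5
      have hs' : ∀ a b, s a = s b → a = b := fun a b h => hs h
      have ht' : ∀ a b, t a = t b → a = b := fun a b h => ht h
      have e1 : z ≠ c := by rintro rfl; exact h1 h2
      have e2 : z1 ≠ c := by rintro rfl; exact h3 h4
      have e3 : s z ≠ c := fun h => e1 (hs' _ _ (h.trans h2.symm))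
      have tri : ∀ a b d e : Fin 3, a ≠ b → a ≠ d → b ≠ d → e = a ∨ e = b ∨ e = d := by decide
      have hssz : s (s z) = z := by
        rcases tri c z (s z) (s (s z)) (Ne.symm e1) (Ne.symm e3) (Ne.symm h1) with h | h | h
        · exact absurd (hs' _ _ (h.trans h2.symm)) e3
        · exact h
        · exact absurd (hs' _ _ h) h1
      have hz1 : s z1 ≠ z1 := by
        rcases tri c z (s z) z1 (Ne.symm e1) (Ne.symm e3) (Ne.symm h1) with h | h | h
        · exact absurd h e2
        · rw [h]; exact h1
        · rw [h, hssz]; exact Ne.symm h1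
      have hsz1c : s z1 ≠ c := fun h => e2 (hs' _ _ (h.trans h2.symm))
      have hssz1 : s (s z1) = z1 := by
        rcases tri c z1 (s z1) (s (s z1)) (Ne.symm e2) (Ne.symm hsz1c) (Ne.symm hz1) with h | h | h
        · exact absurd (hs' _ _ (h.trans h2.symm)) hsz1c
        · exact h
        · exact absurd (hs' _ _ h) hz1
      rcases tri c z1 (s z1) z2 (Ne.symm e2) (Ne.symm hsz1c) (Ne.symm hz1) with h | h | h
      · subst h; rw [h2] at h5; exact h3 h5
      · subst h
        exact hz1 (ht' _ _ (h5.trans h4.symm))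
      · subst h
        rw [hssz1, h4] at h5
        exact hz1 h5.symm
    exact key σ τ hσ.1 hτ.1 c z z1 z2 hz hc hne hz1 hz2
  · push Not at h2
    exact ⟨0, fun c' hc' => absurd ⟨c', hc'⟩ h1, fun τ hτ => h2 τ hτ 0⟩

end

/-! ## Operations of `𝒵₂` -/

open Classical in
/-- Value of `h` at the indicator of a predicate. -/
noncomputable def ind {n : ℕ} (h : (Fin n → Fin 2) → Fin 2) (P : Fin n → Prop) : Fin 2 :=
  h fun l => if P l then 1 else 0

/-- The ternary operation attached to `h`. -/
noncomputable def Tm {n : ℕ} (c : Fin 3) (h : (Fin n → Fin 2) → Fin 2) (x : Fin n → Fin 3) :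
    Fin 3 :=
  if ind h (fun l => x l = c) = 1 then c else if ind h (fun l => x l = c + 1) = 1 then c + 1
    else c + 2

section
variable {n : ℕ} {h : (Fin (n + 1) → Fin 2) → Fin 2} {c : Fin 3}

lemma z2_zero (hh : h ∈ CloneZ2 n) : h (fun _ => 0) = 0 :=
  hh.2.1 (fun _ _ => 0) (fun _ => rfl)

lemma z2_one (hh : h ∈ CloneZ2 n) : h (fun _ => 1) = 1 :=
  hh.2.2 (fun _ _ => 1) (fun _ => rfl)

lemma z2_add3 (hh : h ∈ CloneZ2 n) (a b d : Fin (n + 1) → Fin 2) :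
    h (fun l => a l + b l + d l) = h a + h b + h d :=
  hh.1 (fun l => ![a l, b l, d l, a l + b l + d l]) (fun _ => rfl)

lemma z2_add (hh : h ∈ CloneZ2 n) (a b : Fin (n + 1) → Fin 2) :
    h (fun l => a l + b l) = h a + h b := by
  have := z2_add3 hh a b (fun _ => 0)
  simpa [z2_zero hh] using this

lemma ind_three (hh : h ∈ CloneZ2 n) {P Q R : Fin (n + 1) → Prop}
    (hP : ∀ l, (P l ∧ ¬ Q l ∧ ¬ R l) ∨ (¬ P l ∧ Q l ∧ ¬ R l) ∨ (¬ P l ∧ ¬ Q l ∧ R l)) :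
    ind h P + ind h Q + ind h R = 1 := by
  unfold ind
  rw [← z2_add3 hh]
  refine Eq.trans ?_ (z2_one hh)
  congr 1
  funext l
  rcases hP l with h | h | h <;> simp [h]

lemma ind_compl (hh : h ∈ CloneZ2 n) (P : Fin (n + 1) → Prop) :
    ind h P + ind h (fun l => ¬ P l) = 1 := by
  unfold ind
  rw [← z2_add hh]
  refine Eq.trans ?_ (z2_one hh)
  congr 1
  funext l
  by_cases h : P l <;> simp [h]

lemma ind_congr {P Q : Fin (n + 1) → Prop} (hPQ : ∀ l, P l ↔ Q l) : ind h P = ind h Q := by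
  have : P = Q := funext fun l => propext (hPQ l)
  rw [this]

lemma ind_exists (hh : h ∈ CloneZ2 n) {P : Fin (n + 1) → Prop} (hP : ind h P = 1) :
    ∃ l, P l := by
  by_contra hn
  push Not at hn
  have : ind h P = 0 := by
    rw [← z2_zero hh]
    unfold ind
    simp [hn]
  rw [this] at hP
  exact absurd hP (by decide)

lemma Tm_eq_c {x : Fin (n + 1) → Fin 3} : Tm c h x = c ↔ ind h (fun l => x l = c) = 1 := by
  unfold Tm
  have : ∀ c : Fin 3, c + 1 ≠ c ∧ c + 2 ≠ c := by decide
  split_ifs <;> simp_all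

lemma ind_c3 (hh : h ∈ CloneZ2 n) (x : Fin (n + 1) → Fin 3) :
    ind h (fun l => x l = c) + ind h (fun l => x l = c + 1) + ind h (fun l => x l = c + 2) = 1 := by
  apply ind_three hh
  intro l
  have : ∀ u c : Fin 3, (u = c ∧ ¬ u = c + 1 ∧ ¬ u = c + 2) ∨ (¬ u = c ∧ u = c + 1 ∧ ¬ u = c + 2) ∨
    (¬ u = c ∧ ¬ u = c + 1 ∧ u = c + 2) := by decide
  exact this _ _

lemma Tm_self (hh : h ∈ CloneZ2 n) (x : Fin (n + 1) → Fin 3) :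
    ind h (fun l => x l = Tm c h x) = 1 := by
  have h3 := ind_c3 (c := c) hh x
  unfold Tm
  have : ∀ u v w : Fin 2, u + v + w = 1 → u ≠ 1 → v ≠ 1 → w = 1 := by decide
  split_ifs with h1 h2
  · exact h1
  · exact h2
  · exact this _ _ _ h3 h1 h2

lemma Tm_uniq (hh : h ∈ CloneZ2 n) {x : Fin (n + 1) → Fin 3} {v : Fin 3}
    (h1 : ind h (fun l => x l = c) ≠ 1) (h2 : ind h (fun l => x l = v) = 1) : Tm c h x = v := by
  have h3 := ind_c3 (c := c) hh x
  have hv : ∀ v c : Fin 3, v = c ∨ v = c + 1 ∨ v = c + 2 := by decide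
  unfold Tm
  rw [if_neg h1]
  have : ∀ u v w : Fin 2, u + v + w = 1 → u ≠ 1 → w = 1 → v ≠ 1 := by decide
  rcases hv v c with rfl | rfl | rfl
  · exact absurd h2 h1
  · rw [if_pos h2]
  · rw [if_neg (this _ _ _ h3 h1 h2)]

lemma Tm_comm (hh : h ∈ CloneZ2 n) {σ : Fin 3 → Fin 3} (hσ : Function.Injective σ) (hc : σ c = c)
    (x : Fin (n + 1) → Fin 3) : Tm c h (fun l => σ (x l)) = σ (Tm c h x) := by
  have hi : ∀ v, ind h (fun l => σ (x l) = σ v) = ind h (fun l => x l = v) :=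
    fun v => ind_congr fun l => hσ.eq_iff
  have hi' := hi c
  rw [hc] at hi'
  by_cases h1 : Tm c h x = c
  · rw [h1, hc, Tm_eq_c, hi']
    exact Tm_eq_c.1 h1
  · apply Tm_uniq hh
    · rw [hi']
      exact fun h => h1 (Tm_eq_c.2 h)
    · rw [hi]
      exact Tm_self hh x

lemma Tm_mem (hh : h ∈ CloneZ2 n) (c : Fin 3) (x : Fin (n + 1) → Fin 3) : ∃ l, x l = Tm c h x :=
  ind_exists hh (Tm_self hh x)

lemma z2_sum (hh : h ∈ CloneZ2 n) : ∃ S : Finset (Fin (n + 1)), ∀ y, h y = ∑ l ∈ S, y l := by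
  refine ⟨Finset.univ.filter fun l => h (Pi.single l 1) = 1, fun y => ?_⟩
  have hs : ∀ U : Finset (Fin (n + 1)), ∀ g : Fin (n + 1) → Fin (n + 1) → Fin 2,
      h (fun k => ∑ l ∈ U, g l k) = ∑ l ∈ U, h (g l) := by
    intro U g
    induction U using Finset.induction_on with
    | empty => simpa using z2_zero hh
    | insert a U ha ih =>
      simp only [Finset.sum_insert ha]
      rw [z2_add hh (g a) (fun k => ∑ l ∈ U, g l k), ih]
  have h1 : y = fun k => ∑ l ∈ Finset.univ, (Pi.single l (y l) : Fin (n + 1) → Fin 2) k := by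
    funext k
    simp [Pi.single_apply]
  have h2 : ∀ l, h (Pi.single l (y l)) = if h (Pi.single l 1) = 1 then y l else 0 := by
    intro l
    have hcase : ∀ u : Fin 2, u = 0 ∨ u = 1 := by decide
    rcases hcase (y l) with h0 | h0
    · rw [h0]
      have : (Pi.single l 0 : Fin (n + 1) → Fin 2) = fun _ => 0 := by
        rw [Pi.single_zero]; rfl
      rw [this, z2_zero hh]
      simp
    · rw [h0]
      rcases hcase (h (Pi.single l 1)) with h3 | h3 <;> simp [h3]
  conv_lhs => rw [h1]
  rw [hs]
  simp only [h2]
  rw [Finset.sum_filter]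

end

/-! ## The operation attached to `h` belongs to the clone -/

section
variable {C : Ops (Fin 3)} {n : ℕ} {m : (Fin (2 + 1) → Fin 3) → Fin 3} {c : Fin 3}
  {h : (Fin (n + 1) → Fin 2) → Fin 2}

/-- A fork relation on all of `Fin 3` that is neither equality nor total. -/
lemma fork_thc (hC : IsClone C) (hm : Mal C m) (hg : Good C c) {J : Set (Fin (n + 1) → Fin 3)}
    {x : Fin (n + 1) → Fin 3} (hD : ∀ u, ∃ f ∈ C n, f x = u)
    (h1 : ∃ p q, Fork C n J x p q ∧ p ≠ q) (h2 : ∃ p q, ¬ Fork C n J x p q) :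
    ThC C c ∧ ∀ u v, Fork C n J x u v ↔ (u = c ↔ v = c) := by
  obtain ⟨c', h3, h4⟩ := thc_of_equiv (C := C) (E := Fork C n J x)
    (fun u => by obtain ⟨f, hf, rfl⟩ := hD u; exact Fork.refl hf)
    (fun u v h => h.symm) (fun u v w h h' => h.trans hC hm h')
    (fun k f hf a b hab => Fork.compat hC hf hab) h1 h2
  obtain rfl := hg.th c' h3
  exact ⟨h3, h4⟩

lemma ind_ne {P : Fin (n + 1) → Prop} (hh : h ∈ CloneZ2 n) (hP : ind h P ≠ 1) :
    ind h (fun l => ¬ P l) = 1 := by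
  have h1 := ind_compl hh P
  have : ∀ u v : Fin 2, u + v = 1 → u ≠ 1 → v = 1 := by decide
  exact this _ _ h1 hP

lemma ind_not {P : Fin (n + 1) → Prop} (hh : h ∈ CloneZ2 n) (hP : ind h P = 1) :
    ind h (fun l => ¬ P l) = 0 := by
  have h1 := ind_compl hh P
  have : ∀ u v : Fin 2, u + v = 1 → u = 1 → v = 0 := by decide
  exact this _ _ h1 hP

lemma ind_two_class (hC : IsClone C) (hm : Mal C m) (hg : Good C c) (hh : h ∈ CloneZ2 n)
    {J : Set (Fin (n + 1) → Fin 3)} {x : Fin (n + 1) → Fin 3} {a : Fin 3}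
    (ha : ∃ g ∈ C n, g x = a)
    (h2 : ∀ f ∈ C n, Fork C n J x (f x) (Tm c h x) ∨ Fork C n J x (f x) a)
    (hn : ¬ Fork C n J x a (Tm c h x)) :
    ind h (fun l => Fork C n J x (x l) (Tm c h x)) = 1 := by
  obtain ⟨l0, hl0⟩ := Tm_mem hh c x
  have hT : Fork C n J x (Tm c h x) (Tm c h x) := by
    have := Fork.refl (J := J) (x := x) (hC.proj n l0)
    rwa [hl0] at this
  have hself := Tm_self (c := c) hh x
  by_cases hD : ∀ u, ∃ f ∈ C n, f x = u
  · by_cases he : ∃ p q, Fork C n J x p q ∧ p ≠ q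
    · obtain ⟨-, hE⟩ := fork_thc hC hm hg hD he ⟨_, _, hn⟩
      by_cases hc : Tm c h x = c
      · rw [← hself]
        apply ind_congr
        intro l
        rw [hE, hc]
        simp
      · refine Eq.trans (ind_congr ?_) (ind_ne hh fun h => hc (Tm_eq_c.2 h))
        intro l
        rw [hE]
        simp [hc]
    · push Not at he
      rw [← hself]
      apply ind_congr
      intro l
      exact ⟨he _ _, fun h => h ▸ hT⟩
  · push Not at hD
    obtain ⟨u, hu⟩ := hD
    rw [← hself]
    apply ind_congr
    intro l
    refine ⟨fun h3 => ?_, fun h => h ▸ hT⟩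
    have n1 : x l ≠ u := hu _ (hC.proj n l)
    have n2 : Tm c h x ≠ u := by rw [← hl0]; exact hu _ (hC.proj n l0)
    have n3 : a ≠ u := by obtain ⟨g, hg, rfl⟩ := ha; exact hu g hg
    have n4 : a ≠ Tm c h x := by rintro h4; exact hn (h4 ▸ hT)
    have n5 : x l ≠ a := by rintro h4; exact hn (h4 ▸ h3)
    omega

lemma fork_link (hC : IsClone C) (hm : Mal C m) {x y : Fin (n + 1) → Fin 3}
    {f g : (Fin (n + 1) → Fin 3) → Fin 3} (hf : f ∈ C n) (hg : g ∈ C n)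
    (hfg : Fork C n {y} x (f x) (g x)) : Fork C n {x} y (f y) (g y) := by
  obtain ⟨s, hs, h1, h2⟩ := hfg.shift hC hm hf rfl
  refine ⟨s, hs, g, hg, ?_, h1 y rfl, rfl⟩
  rintro z rfl
  exact h2

lemma fork_iff (hC : IsClone C) (hm : Mal C m) {x y : Fin (n + 1) → Fin 3}
    {f g : (Fin (n + 1) → Fin 3) → Fin 3} (hf : f ∈ C n) (hg : g ∈ C n) :
    Fork C n {y} x (f x) (g x) ↔ Fork C n {x} y (f y) (g y) :=
  ⟨fork_link hC hm hf hg, fork_link hC hm hf hg⟩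

lemma pair_false (hC : IsClone C) (hm : Mal C m) (hg : Good C c) (hh : h ∈ CloneZ2 n)
    {x y : Fin (n + 1) → Fin 3} {wx wy : (Fin (n + 1) → Fin 3) → Fin 3}
    (hwx : wx ∈ C n) (hwy : wy ∈ C n) (h1 : wx y = Tm c h y) (h2 : wy x = Tm c h x)
    (hno : ¬ ∃ f ∈ C n, f x = Tm c h x ∧ f y = Tm c h y) : False := by
  have hnx : ¬ Fork C n {y} x (wx x) (Tm c h x) := by
    intro h3
    obtain ⟨s, hs, h4, h5⟩ := h3.shift hC hm hwx rfl
    exact hno ⟨s, hs, h5, (h4 y rfl).trans h1⟩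
  have hny : ¬ Fork C n {x} y (wy y) (Tm c h y) := by
    intro h3
    obtain ⟨s, hs, h4, h5⟩ := h3.shift hC hm hwy rfl
    exact hno ⟨s, hs, (h4 x rfl).trans h2, h5⟩
  by_cases hx : ∀ f ∈ C n, Fork C n {y} x (f x) (Tm c h x) ∨ Fork C n {y} x (f x) (wx x)
  · have hy : ∀ f ∈ C n, Fork C n {x} y (f y) (Tm c h y) ∨ Fork C n {x} y (f y) (wy y) := by
      intro f hf
      rcases hx f hf with h3 | h3
      · rw [← h2] at h3
        exact Or.inr (fork_link hC hm hf hwy h3)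
      · left
        rw [← h1]
        exact fork_link hC hm hf hwx h3
    have k1 := ind_two_class hC hm hg hh ⟨wx, hwx, rfl⟩ hx hnx
    have k2 := ind_two_class hC hm hg hh ⟨wy, hwy, rfl⟩ hy hny
    have k3 : ind h (fun l => Fork C n {x} y (y l) (Tm c h y)) =
        ind h (fun l => ¬ Fork C n {y} x (x l) (Tm c h x)) := by
      apply ind_congr
      intro l
      have h5 : Fork C n {x} y (y l) (Tm c h y) ↔ Fork C n {y} x (x l) (wx x) := by
        rw [← h1]
        exact fork_iff hC hm (hC.proj n l) hwx
      rw [h5]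
      constructor
      · intro h6 h7
        exact hnx (h6.symm.trans hC hm h7)
      · intro h6
        exact (hx _ (hC.proj n l)).resolve_left h6
    rw [k3, ind_not hh k1] at k2
    exact absurd k2 (by decide)
  · have hy : ¬ ∀ f ∈ C n, Fork C n {x} y (f y) (Tm c h y) ∨ Fork C n {x} y (f y) (wy y) := by
      intro hy
      apply hx
      intro f hf
      rcases hy f hf with h3 | h3
      · rw [← h1] at h3
        exact Or.inr (fork_link hC hm hf hwx h3)
      · left
        rw [← h2]
        exact fork_link hC hm hf hwy h3
    push Not at hx hy
    obtain ⟨f, hf, hf1, hf2⟩ := hx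
    obtain ⟨g, hgg, hg1, hg2⟩ := hy
    obtain ⟨hall, hex⟩ := three_classes (E := Fork C n {y} x) (fun u v h => h.symm)
      (fun h => hnx h.symm) hf1 hf2 (by rw [← h2]; exact Fork.refl hwy) (Fork.refl hwx)
    obtain ⟨-, hey⟩ := three_classes (E := Fork C n {x} y) (fun u v h => h.symm)
      (fun h => hny h.symm) hg1 hg2 (by rw [← h1]; exact Fork.refl hwx) (Fork.refl hwy)
    have hD : ∀ u, ∃ f ∈ C n, f x = u := by
      intro u
      rcases hall u with rfl | rfl | rfl
      · exact ⟨_, hwy, h2⟩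
      · exact ⟨_, hwx, rfl⟩
      · exact ⟨f, hf, rfl⟩
    choose F hF hFx using hD
    let σ : Fin 3 → Fin 3 := fun u => F u y
    have hσ : ∀ f ∈ C n, f y = σ (f x) := by
      intro f hf
      apply hey
      apply fork_link hC hm hf (hF _)
      rw [hFx]
      exact Fork.refl hf
    have hinj : Function.Injective σ := by
      intro u v huv
      have h3 : Fork C n {x} y (F u y) (F v y) := by
        have : F u y = F v y := huv
        rw [this]
        exact Fork.refl (hF v)
      have := hex _ _ (fork_link hC hm (hF u) (hF v) h3)
      rwa [hFx, hFx] at this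
    have hauto : Auto C σ := by
      refine ⟨hinj, fun k p hp z => ?_⟩
      have h3 := hσ _ (hC.comp k n p (fun l => F (z l)) hp fun l => hF _)
      simp only [hFx] at h3
      exact h3
    have hyx : y = fun l => σ (x l) := funext fun l => hσ _ (hC.proj n l)
    have h4 := Tm_comm (c := c) hh hinj (hg.au σ hauto) x
    rw [← hyx, ← h2, ← hσ wy hwy] at h4
    exact hno ⟨wy, hwy, h2, h4.symm⟩

/-- The two-class points. -/
lemma tc_step (hC : IsClone C) (hm : Mal C m) (hg : Good C c) (hh : h ∈ CloneZ2 n)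
    {I : Finset (Fin (n + 1) → Fin 3)} (hc : Crit C n (Tm c h) I)
    {i j k : Fin (n + 1) → Fin 3} (hj : j ∈ I) (hk : k ∈ I) (hij : i ≠ j)
    (hik : i ≠ k) (hjk : j ≠ k) {w : (Fin (n + 1) → Fin 3) → Fin 3} (hw : w ∈ C n)
    (hwi : ∀ y ∈ I, y ≠ i → w y = Tm c h y)
    (h2 : ∀ f ∈ C n, Gam C n I i (f i) (Tm c h i) ∨ Gam C n I i (f i) (w i))
    {S : Finset (Fin (n + 1))} (hS : ∀ y, h y = ∑ l ∈ S, y l)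
    {F : (Fin (n + 1) → Fin 3) → Fin 3}
    (hF : ∀ (D : Fin 3 → Prop)
      (π : Fin 3 → Fin 2), (∀ x y z, D x → D y → D z →
        D (m ![x, y, z]) ∧ π (m ![x, y, z]) = π x + π y + π z) →
      ∀ x : Fin (n + 1) → Fin 3, (∀ l ∈ S, D (x l)) →
        D (F x) ∧ π (F x) = ∑ l ∈ S, π (x l)) :
    Gam C n I i (F i) (Tm c h i) := by
  classical
  have hq := quo_of_fork hC hm h2
  obtain ⟨l0, hl0⟩ := Tm_mem hh c i
  have hDT : ∃ f ∈ C n, f i = Tm c h i := ⟨_, hC.proj n l0, hl0⟩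
  have hT : Gam C n I i (Tm c h i) (Tm c h i) := by
    have := Fork.refl (J := {y | y ∈ I ∧ y ≠ i}) (x := i) (hC.proj n l0)
    rwa [hl0] at this
  have hng := hc.not_gam hC hm hw hwi
  have hmin := hq.mino hC hm hDT ⟨w, hw, rfl⟩ (if_pos hT) (if_neg hng)
    (fun s hs => if_neg (hc.bad hC hj hk hij hik hjk hw hwi hs))
  obtain ⟨-, h3⟩ := hF (fun u => ∃ f ∈ C n, f i = u)
    (fun u => if Gam C n I i u (Tm c h i) then 0 else 1) hmin i (fun l _ => ⟨_, hC.proj n l, rfl⟩)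
  have h4 : ∑ l ∈ S, (if Gam C n I i (i l) (Tm c h i) then (0 : Fin 2) else 1) = 0 := by
    rw [← hS]
    refine Eq.trans ?_ (ind_not hh (ind_two_class hC hm hg hh ⟨w, hw, rfl⟩ h2 hng))
    unfold ind
    congr 1
    funext l
    by_cases h5 : Gam C n I i (i l) (Tm c h i) <;> simp [h5]
  have h3 := h3.trans h4
  by_contra h5
  rw [if_neg h5] at h3
  exact absurd h3 (by decide)

/-- The points that are not two-class. -/
lemma not_tc (hC : IsClone C) (hid : Idem C) (hm : Mal C m)
    (hphi : ¬ ∀ n, ∀ f ∈ C n, Preserves f phi) (hg : Good C c) (hh : h ∈ CloneZ2 n)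
    {I : Finset (Fin (n + 1) → Fin 3)} (hc : Crit C n (Tm c h) I)
    {i j k : Fin (n + 1) → Fin 3} (hi : i ∈ I) (hj : j ∈ I) (hk : k ∈ I) (hij : i ≠ j)
    (hik : i ≠ k) (hjk : j ≠ k) {w : (Fin (n + 1) → Fin 3) → Fin 3} (hw : w ∈ C n)
    (hwi : ∀ y ∈ I, y ≠ i → w y = Tm c h y) (hwne : w i ≠ Tm c h i)
    (h2 : ¬ ∀ f ∈ C n, Gam C n I i (f i) (Tm c h i) ∨ Gam C n I i (f i) (w i)) :
    (∀ u, ∃ f ∈ C n, f i = u) ∧ ThC C c ∧ (∀ u v, Fork C n {j} i u v ↔ (u = c ↔ v = c)) ∧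
      Tm c h i ≠ c ∧ w i ≠ c := by
  obtain ⟨l0, hl0⟩ := Tm_mem hh c i
  have hT : Gam C n I i (Tm c h i) (Tm c h i) := by
    have := Fork.refl (J := {y | y ∈ I ∧ y ≠ i}) (x := i) (hC.proj n l0)
    rwa [hl0] at this
  have hng := hc.not_gam hC hm hw hwi
  push Not at h2
  obtain ⟨f, hf, hf1, hf2⟩ := h2
  obtain ⟨hall, heq⟩ := three_classes (E := Gam C n I i) (fun u v h => h.symm)
    (fun h => hng h.symm) hf1 hf2 hT (Fork.refl hw)
  have hD : ∀ u, ∃ f ∈ C n, f i = u := by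
    intro u
    rcases hall u with rfl | rfl | rfl
    · exact ⟨_, hC.proj n l0, hl0⟩
    · exact ⟨_, hw, rfl⟩
    · exact ⟨f, hf, rfl⟩
  obtain ⟨wj, hwj, hj1, -⟩ := hc.wit hj
  obtain ⟨wk, hwk, hk1, -⟩ := hc.wit hk
  let K : Set (Fin (n + 1) → Fin 3) := {y | y ∈ I ∧ y ≠ i ∧ y ≠ j}
  have hJK : ∀ u v, Fork C n ({j} ∪ K) i u v → u = v := by
    intro u v huv
    apply heq
    apply huv.mono
    rintro y ⟨hy, hyi⟩
    by_cases hyj : y = j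
    · left; exact hyj
    · right; exact ⟨hy, hyi, hyj⟩
  have e1 : Fork C n {j} i (w i) (Tm c h i) := by
    refine ⟨w, hw, wk, hwk, ?_, rfl, hk1 i hi hik⟩
    rintro y rfl
    rw [hwi y hj (Ne.symm hij), hk1 y hj hjk]
  have e2 : Fork C n K i (w i) (Tm c h i) := by
    refine ⟨w, hw, wj, hwj, ?_, rfl, hj1 i hi hij⟩
    rintro y ⟨hy, hyi, hyj⟩
    rw [hwi y hy hyi, hj1 y hy hyj]
  have hnt : ∃ p q, ¬ Fork C n {j} i p q := by
    by_contra htot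
    push Not at htot
    by_cases ht2 : ∀ p q, Fork C n K i p q
    · exact hphi (abelian_phi hC hid hm 0 (J := {j}) (K := K) (x := i) (fun u => htot _ _)
        (fun u => ht2 _ _) hJK)
    · push Not at ht2
      obtain ⟨hth, hE⟩ := fork_thc hC hm hg hD ⟨_, _, e2, hwne⟩ ht2
      have n1 : ∀ c : Fin 3, c + 1 ≠ c ∧ c + 2 ≠ c ∧ c + 1 ≠ c + 2 := by decide
      obtain ⟨n1, n2, n3⟩ := n1 c
      have h5 := Fork.diff hC hm (htot (c + 1) c)
        ((hE (c + 1) (c + 2)).2 (by simp only [n1, n2]))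
      rw [hth.m_eq hm n1 n2, (hm.2 _ _).1] at h5
      exact n3 (hJK _ _ h5)
  obtain ⟨hth, hE⟩ := fork_thc hC hm hg hD ⟨_, _, e1, hwne⟩ hnt
  have h6 := (hE _ _).1 e1
  refine ⟨hD, hth, hE, ?_, ?_⟩
  · intro h7
    exact hwne ((h6.2 h7).trans h7.symm)
  · intro h7
    exact hwne (h7.trans (h6.1 h7).symm)

lemma big_false (hC : IsClone C) (hid : Idem C) (hm : Mal C m)
    (hphi : ¬ ∀ n, ∀ f ∈ C n, Preserves f phi) (hg : Good C c) (hh : h ∈ CloneZ2 n)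
    {I : Finset (Fin (n + 1) → Fin 3)} (hc : Crit C n (Tm c h) I) (hcard : 2 < I.card) :
    False := by
  classical
  obtain ⟨S, hS⟩ := z2_sum hh
  have hodd : ∀ U : Finset (Fin (n + 1)), (∑ l ∈ U, (1 : Fin 2)) = 1 → ∃ k, U.card = 2 * k + 1 := by
    intro U hU
    rw [Finset.sum_const] at hU
    have h0 : ∀ k : ℕ, k • (1 : Fin 2) = if k % 2 = 1 then 1 else 0 := by
      intro k
      induction k with
      | zero => simp
      | succ k ih =>
        rw [succ_nsmul, ih]
        rcases Nat.mod_two_eq_zero_or_one k with h1 | h1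
        · rw [if_neg (by omega), if_pos (by omega)]; rfl
        · rw [if_pos h1, if_neg (by omega)]; rfl
    have h1 : U.card % 2 = 1 := by
      by_contra h2
      rw [h0, if_neg h2] at hU
      exact absurd hU (by decide)
    exact ⟨U.card / 2, by omega⟩
  -- two further points
  have hthird : ∀ i ∈ I, ∀ j ∈ I, ∃ k ∈ I, k ≠ i ∧ k ≠ j := by
    intro i hi j hj
    by_contra hno
    push Not at hno
    have : I ⊆ {i, j} := by
      intro y hy
      by_cases hyi : y = i
      · simp [hyi]
      · simp [hno y hy hyi]
    have := Finset.card_le_card this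
    have := Finset.card_le_two (a := i) (b := j)
    omega
  have hwit : ∀ i : Fin (n + 1) → Fin 3, ∃ w, i ∈ I → w ∈ C n ∧
      (∀ y ∈ I, y ≠ i → w y = Tm c h y) ∧ w i ≠ Tm c h i := by
    intro i
    by_cases hi : i ∈ I
    · obtain ⟨w, hw⟩ := hc.wit hi
      exact ⟨w, fun _ => hw⟩
    · exact ⟨fun _ => 0, fun h => absurd h hi⟩
  choose w hw using hwit
  by_cases hall : ∀ i ∈ I, ∀ f ∈ C n, Gam C n I i (f i) (Tm c h i) ∨ Gam C n I i (f i) (w i i)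
  · obtain ⟨k, hk⟩ := hodd S (by rw [← hS]; exact z2_one hh)
    obtain ⟨F, hF, hF2⟩ := exists_sum hC hm k S hk
    refine hc.not_interp (adjust hC hm hF fun i hi => ?_)
    obtain ⟨j, hj, hji, -⟩ := hthird i hi i hi
    obtain ⟨k, hk, hki, hkj⟩ := hthird i hi j hj
    exact tc_step hC hm hg hh hc hj hk (Ne.symm hji) (Ne.symm hki) (Ne.symm hkj) (hw i hi).1
      (hw i hi).2.1 (hall i hi) hS hF2
  · push Not at hall
    obtain ⟨i, hi, hni⟩ := hall
    have hni : ¬ ∀ f ∈ C n, Gam C n I i (f i) (Tm c h i) ∨ Gam C n I i (f i) (w i i) := by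
      push Not
      exact hni
    have hnt : ∀ i ∈ I, (¬ ∀ f ∈ C n, Gam C n I i (f i) (Tm c h i) ∨ Gam C n I i (f i) (w i i)) →
        ∀ j ∈ I, i ≠ j → (∀ u, ∃ f ∈ C n, f i = u) ∧ ThC C c ∧
        (∀ u v, Fork C n {j} i u v ↔ (u = c ↔ v = c)) ∧ Tm c h i ≠ c ∧ w i i ≠ c := by
      intro i hi hni j hj hij
      obtain ⟨k, hk, hki, hkj⟩ := hthird i hi j hj
      exact not_tc hC hid hm hphi hg hh hc hi hj hk hij (Ne.symm hki) (Ne.symm hkj) (hw i hi).1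
        (hw i hi).2.1 (hw i hi).2.2 hni
    have hallj : ∀ j ∈ I,
        ¬ ∀ f ∈ C n, Gam C n I j (f j) (Tm c h j) ∨ Gam C n I j (f j) (w j j) := by
      intro j hj htc
      have hij : i ≠ j := by
        rintro rfl
        exact hni htc
      obtain ⟨hD, -, hE, -, -⟩ := hnt i hi hni j hj hij
      obtain ⟨k, hk, hki, hkj⟩ := hthird i hi j hj
      have e1 : Fork C n {i} j (w j j) (Tm c h j) := by
        refine ⟨w j, (hw j hj).1, w k, (hw k hk).1, ?_, rfl, (hw k hk).2.1 j hj (Ne.symm hkj)⟩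
        rintro y rfl
        rw [(hw j hj).2.1 y hi hij, (hw k hk).2.1 y hi (Ne.symm hki)]
      have hsub : ({i} : Set (Fin (n + 1) → Fin 3)) ⊆ {y | y ∈ I ∧ y ≠ j} := by
        rintro y rfl
        exact ⟨hi, hij⟩
      have e2 : ∀ f ∈ C n, Fork C n {i} j (f j) (Tm c h j) := by
        intro f hf
        rcases htc f hf with h3 | h3
        · exact h3.mono hsub
        · exact (h3.mono hsub).trans hC hm e1
      obtain ⟨f, hf, hfi⟩ := hD c
      obtain ⟨g, hgg, hgi⟩ := hD (c + 1)
      have e3 := fork_link hC hm hf hgg ((e2 f hf).trans hC hm (e2 g hgg).symm)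
      rw [hE, hfi, hgi] at e3
      have n1 : ∀ c : Fin 3, c + 1 ≠ c := by decide
      exact n1 c (e3.1 rfl)
    obtain ⟨j0, hj0, hj0i, -⟩ := hthird i hi i hi
    obtain ⟨-, hth, -, hTi, -⟩ := hnt i hi hni j0 hj0 (Ne.symm hj0i)
    have hTw : ∀ j ∈ I, Tm c h j ≠ c ∧ w j j ≠ c := by
      intro j hj
      obtain ⟨k, hk, hkj, -⟩ := hthird j hj j hj
      exact (hnt j hj (hallj j hj) k hk (Ne.symm hkj)).2.2.2
    have hpat : ∀ j ∈ I, ∀ l, j l = c ↔ i l = c := by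
      intro j hj
      by_cases hij : i = j
      · subst hij; intro l; rfl
      have E1 := (hnt i hi hni j hj hij).2.2.1
      have E2 := (hnt j hj (hallj j hj) i hi (Ne.symm hij)).2.2.1
      have hl : ∀ l l', (i l = c ↔ i l' = c) ↔ (j l = c ↔ j l' = c) := by
        intro l l'
        rw [← E1, ← E2]
        exact fork_iff hC hm (hC.proj n l) (hC.proj n l')
      obtain ⟨l0, hl0⟩ := Tm_mem hh c i
      have hil0 : i l0 ≠ c := by rw [hl0]; exact hTi
      by_cases hjl0 : j l0 = c
      · exfalso
        apply (hTw j hj).1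
        rw [Tm_eq_c]
        refine Eq.trans (ind_congr ?_) (ind_ne hh fun h => hTi (Tm_eq_c.2 h))
        intro l
        have := hl l l0
        simp only [hil0, hjl0, iff_false, iff_true] at this
        exact this.symm
      · intro l
        have := hl l l0
        simp only [hil0, hjl0, iff_false] at this
        exact (not_iff_not.1 this).symm
    have hS' : ∑ l ∈ S.filter (fun l => i l ≠ c), (1 : Fin 2) = 1 := by
      rw [Finset.sum_filter, ← hS]
      refine Eq.trans ?_ (ind_ne hh fun h => hTi (Tm_eq_c.2 h))
      unfold ind
      congr 1
      funext l
      by_cases h5 : i l = c <;> simp [h5]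
    obtain ⟨k, hk⟩ := hodd _ hS'
    obtain ⟨F, hF, hF2⟩ := exists_sum hC hm k _ hk
    refine hc.not_interp ⟨F, hF, fun j hj => ?_⟩
    obtain ⟨hTj, hwj⟩ := hTw j hj
    obtain ⟨hw1, hw2, hw3⟩ := hw j hj
    let π : Fin 3 → Fin 2 := fun u => if u = Tm c h j then 0 else 1
    have hq : Quo C (fun u => u ≠ c) π := by
      constructor
      · intro k f hf x hx h5
        have h6 := (hth k f hf x (fun _ => Tm c h j) (fun l => by simp only [hx l, hTj])).1 h5
        rw [hid k f hf] at h6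
        exact hTj h6
      · intro k f hf x y hx hy hxy
        have : x = y := by
          funext l
          have h5 := hxy l
          have key : ∀ t c u v : Fin 3, t ≠ c → u ≠ c → v ≠ c →
              (if u = t then (0 : Fin 2) else 1) = (if v = t then 0 else 1) → u = v := by decide
          exact key _ _ _ _ hTj (hx l) (hy l) h5
        rw [this]
    obtain ⟨p, hp, hpj, -⟩ := hthird j hj j hj
    obtain ⟨q, hq', hqj, hqp⟩ := hthird j hj p hp
    have hT : Gam C n I j (Tm c h j) (Tm c h j) := by
      have := Fork.refl (J := {y | y ∈ I ∧ y ≠ j}) (x := j) (hw p hp).1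
      rwa [(hw p hp).2.1 j hj (Ne.symm hpj)] at this
    have hmin := hq.mino hC hm hTj hwj (if_pos rfl) (if_neg hw3) (fun s hs => by
      refine if_neg fun h5 => hc.bad hC hp hq' (Ne.symm hpj) (Ne.symm hqj) (Ne.symm hqp) hw1 hw2 hs ?_
      rw [h5]
      exact hT)
    obtain ⟨h5, h6⟩ := hF2 _ _ hmin j (fun l hl => by
      rw [Ne, hpat j hj]
      exact (Finset.mem_filter.1 hl).2)
    have h7 : ∑ l ∈ S.filter (fun l => i l ≠ c), π (j l) = 0 := by
      have h8 := ind_three hh (P := fun l => j l = c) (Q := fun l => j l = Tm c h j)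
        (R := fun l => j l ≠ c ∧ j l ≠ Tm c h j) (by
          intro l
          by_cases h9 : j l = c
          · simp [h9, Ne.symm hTj]
          · by_cases h10 : j l = Tm c h j
            · simp [h10, hTj]
            · simp [h9, h10])
      have h9 := Tm_self (c := c) hh j
      have h10 : ind h (fun l => j l = c) ≠ 1 := fun h => hTj (Tm_eq_c.2 h)
      have key : ∀ u v w : Fin 2, u + v + w = 1 → v = 1 → u ≠ 1 → w = 0 := by decide
      rw [← key _ _ _ h8 h9 h10, Finset.sum_filter, ← hS]
      unfold ind
      congr 1
      funext l
      have := hpat j hj l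
      by_cases h11 : j l = c <;> by_cases h12 : j l = Tm c h j <;> simp [π, h11, h12, ← this]
    have h6 := h6.trans h7
    by_contra h8
    rw [show π (F j) = 1 from if_neg h8] at h6
    exact absurd h6 (by decide)

lemma Tm_mem_clone (hC : IsClone C) (hid : Idem C) (hm : Mal C m)
    (hphi : ¬ ∀ n, ∀ f ∈ C n, Preserves f phi) (hg : Good C c) (hh : h ∈ CloneZ2 n) :
    Tm c h ∈ C n := by
  by_contra hno
  have hni : ¬ Interp C n (Tm c h) Finset.univ := by
    rintro ⟨f, hf, h1⟩
    apply hno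
    have : f = Tm c h := funext fun y => h1 y (Finset.mem_univ y)
    rwa [← this]
  obtain ⟨I, -, hc⟩ := exists_crit _ hni
  by_cases hcard : 2 < I.card
  · exact big_false hC hid hm hphi hg hh hc hcard
  have hle : I.card ≤ 2 := by omega
  interval_cases hcd : I.card
  · rw [Finset.card_eq_zero] at hcd
    subst hcd
    exact hc.not_interp ⟨_, hC.proj n 0, by simp⟩
  · obtain ⟨p, rfl⟩ := Finset.card_eq_one.1 hcd
    obtain ⟨l, hl⟩ := Tm_mem hh c p
    refine hc.not_interp ⟨_, hC.proj n l, fun y hy => ?_⟩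
    rw [Finset.mem_singleton] at hy
    subst hy
    exact hl
  · obtain ⟨x, y, hxy, rfl⟩ := Finset.card_eq_two.1 hcd
    obtain ⟨wx, hwx, h1, -⟩ := hc.wit (i := x) (by simp)
    obtain ⟨wy, hwy, h2, -⟩ := hc.wit (i := y) (by simp)
    refine pair_false hC hm hg hh hwx hwy (h1 y (by simp) (Ne.symm hxy)) (h2 x (by simp) hxy) ?_
    rintro ⟨f, hf, h3, h4⟩
    refine hc.not_interp ⟨f, hf, fun z hz => ?_⟩
    rw [Finset.mem_insert, Finset.mem_singleton] at hz
    rcases hz with rfl | rfl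
    · exact h3
    · exact h4

lemma from_Z2 (hC : IsClone C) (hid : Idem C) (hm : Mal C m)
    (hphi : ¬ ∀ n, ∀ f ∈ C n, Preserves f phi) : MinorLE CloneZ2 C := by
  obtain ⟨c, hg⟩ := exists_good hm hphi
  exact ⟨fun n h => Tm c h, fun n h hh => Tm_mem_clone hC hid hm hphi hg hh,
    fun n r f σ hf => rfl⟩

end

/-- Every idempotent Mal'cev clone on `{0,1,2}` without a majority operation and with some
operation not preserving `φ` is minor-equivalent to `𝒵₂`. -/
theorem stmt3 (C : Ops (Fin 3)) (hC : IsClone C)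
    (hid : ∀ n, ∀ f ∈ C n, ∀ a : Fin 3, f (fun _ => a) = a)
    (hmal : ∃ m ∈ C 2, ∀ x y : Fin 3, m ![y, x, x] = y ∧ m ![x, x, y] = y)
    (hnomaj : ¬ ∃ m ∈ C 2, ∀ x y : Fin 3,
      m ![x, x, y] = x ∧ m ![x, y, x] = x ∧ m ![y, x, x] = x)
    (hphi : ∃ n, ∃ f ∈ C n, ¬ Preserves f phi) :
    MinorEquiv C CloneZ2 := by
  obtain ⟨m, hm1, hm2⟩ := hmal
  have hm : Mal C m := ⟨hm1, hm2⟩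
  have hphi' : ¬ ∀ n, ∀ f ∈ C n, Preserves f phi := by
    intro h
    obtain ⟨n, f, hf, hn⟩ := hphi
    exact hn (h n f hf)
  obtain ⟨t, a, hbad⟩ := exists_bad hC hm hnomaj
  exact ⟨to_Z2 hC hid hm hphi' hbad, from_Z2 hC hid hm hphi'⟩
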